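/- Let f_0,…,f_{n+1} ∈ S_d (d ≥ 1) be linearly independent homogeneous polynomials with no common zero in projective n-space over an algebraic closure of k (equivalently, S/(f_0,…,f_{n+1}) is a finite-dimensional k-vector space). Let I = (f_0,…,f_{n+1}), R = S/I, ρ = (n+1)(d−1), and fix an integer a with 0 ≤ a ≤ ρ. Let Syz_{a+d} = {(A_0,…,A_{n+1}) ∈ (S_a)^{n+2} : ∑_i A_i f_i = 0} and let Kosz_{a+d} ⊆ Syz_{a+d} be the k-span of the Koszul syzygies p·(f_j e_i − f_i e_j) for p ∈ S_{a−d} and 0 ≤ i < j ≤ n+1 (e_i the standard basis vectors). Then the map sending φ ∈ (R_{ρ−a})^* (regarded as a functional on S_{ρ−a} vanishing on I_{ρ−a}) to the class of the Bezout syzygy ((−1)^i ∑_{|α|=a} φ(Δ^i_α) x^α)_{i=0}^{n+1} induces a k-linear isomorphism (R_{ρ−a})^* ≅ Syz_{a+d}/Kosz_{a+d}. -/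

import Mathlib

open MvPolynomial

set_option synthInstance.maxHeartbeats 1000000
set_option maxSynthPendingDepth 3
set_option maxHeartbeats 1000000

noncomputable section

/-- The "mixed" variable assignment: variables with index `< j` are sent to the
`y`-variables (the second summand), variables with index `≥ j` to the `x`-variables
(the first summand). -/
def mixv (k : Type*) [Field k] (n : ℕ) (j : ℕ) :
    Fin (n + 1) → MvPolynomial (Fin (n + 1) ⊕ Fin (n + 1)) k :=
  fun i => if (i : ℕ) < j then X (Sum.inr i) else X (Sum.inl i)

/-- `D` is the `j`-th divided difference `Δ_j(f)` of `f`. -/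
def IsDivDiff (k : Type*) [Field k] (n : ℕ) (f : MvPolynomial (Fin (n + 1)) k)
    (j : Fin (n + 1)) (D : MvPolynomial (Fin (n + 1) ⊕ Fin (n + 1)) k) : Prop :=
  D * (X (Sum.inl j) - X (Sum.inr j)) =
    aeval (mixv k n (j : ℕ)) f - aeval (mixv k n ((j : ℕ) + 1)) f

/-- Writing `Q ∈ k[x_0,…,x_n,y_0,…,y_n]` as `∑_α Q_α(x) y^α`, this is the coefficient
`Q_α(x) ∈ k[x_0,…,x_n]` of the monomial `y^α`. -/
def coeffY (k : Type*) [Field k] (n : ℕ) (Q : MvPolynomial (Fin (n + 1) ⊕ Fin (n + 1)) k)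
    (α : Fin (n + 1) →₀ ℕ) : MvPolynomial (Fin (n + 1)) k :=
  MvPolynomial.coeff α ((sumAlgEquiv k (Fin (n + 1)) (Fin (n + 1))) (rename Sum.swap Q))

/-- The `ℤ`-indexed graded piece `S_m ⊆ S = k[x_0,…,x_n]` (zero in negative degrees). -/
def gradedPiece (k : Type*) [Field k] (n : ℕ) (m : ℤ) :
    Submodule k (MvPolynomial (Fin (n + 1)) k) :=
  if 0 ≤ m then homogeneousSubmodule (Fin (n + 1)) k m.toNat else ⊥

/-- The linear map `(S_a)^{n+2} → S`, `(A_0,…,A_{n+1}) ↦ ∑ A_i f_i`; its kernel is the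
space of syzygies of `f_0,…,f_{n+1}` (in the appropriate degree). -/
def syzMap (k : Type*) [Field k] (n : ℕ) (a : ℤ)
    (f : Fin (n + 2) → MvPolynomial (Fin (n + 1)) k) :
    (Fin (n + 2) → ↥(gradedPiece k n a)) →ₗ[k] MvPolynomial (Fin (n + 1)) k :=
  ∑ i : Fin (n + 2),
    (LinearMap.mulRight k (f i)).comp
      (((gradedPiece k n a).subtype).comp (LinearMap.proj i))

/-- The submodule of Koszul syzygies `p·(f_j e_i − f_i e_j)`, `p ∈ S_{a−d}`, inside the
space of all syzygies with entries in `S_a`. -/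
def koszulSyzygies (k : Type*) [Field k] (n : ℕ) (a : ℤ) (d : ℕ)
    (f : Fin (n + 2) → MvPolynomial (Fin (n + 1)) k) :
    Submodule k ↥(LinearMap.ker (syzMap k n a f)) :=
  Submodule.span k
    {A | ∃ p ∈ gradedPiece k n (a - d), ∃ i j : Fin (n + 2), i < j ∧
      ∀ t, ((A : Fin (n + 2) → ↥(gradedPiece k n a)) t : MvPolynomial (Fin (n + 1)) k) =
        p * (if t = i then f j else if t = j then -f i else 0)}

/-- Functionals on `S_b` vanishing on `I ∩ S_b`, i.e. the dual of `(S/I)_b`. -/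
def vanishingDual (k : Type*) [Field k] (n : ℕ) (b : ℤ)
    (I : Ideal (MvPolynomial (Fin (n + 1)) k)) :
    Submodule k (Module.Dual k ↥(gradedPiece k n b)) :=
  ⨅ x ∈ {x : ↥(gradedPiece k n b) | (x : MvPolynomial (Fin (n + 1)) k) ∈ I},
    LinearMap.ker (LinearMap.applyₗ x)



section Ext
variable {R : Type*} [CommRing R] {m : ℕ}

/-- The Koszul differential attached to a functional. -/
def kd (δ : Module.Dual R (Fin m → R)) :
    ExteriorAlgebra R (Fin m → R) →ₗ[R] ExteriorAlgebra R (Fin m → R) :=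
  CliffordAlgebra.contractLeft (Q := (0 : QuadraticForm R (Fin m → R))) δ

lemma kd_ι_mul (δ : Module.Dual R (Fin m → R)) (a : Fin m → R)
    (x : ExteriorAlgebra R (Fin m → R)) :
    kd δ (ExteriorAlgebra.ι R a * x) = δ a • x - ExteriorAlgebra.ι R a * kd δ x :=
  CliffordAlgebra.contractLeft_ι_mul _ _ _

lemma kd_one (δ : Module.Dual R (Fin m → R)) : kd δ 1 = 0 :=
  CliffordAlgebra.contractLeft_one (Q := (0 : QuadraticForm R (Fin m → R))) δ

lemma kd_ι (δ : Module.Dual R (Fin m → R)) (a : Fin m → R) :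
    kd δ (ExteriorAlgebra.ι R a) = algebraMap R _ (δ a) :=
  CliffordAlgebra.contractLeft_ι (Q := (0 : QuadraticForm R (Fin m → R))) δ a

lemma kd_algebraMap (δ : Module.Dual R (Fin m → R)) (r : R) : kd δ (algebraMap R _ r) = 0 :=
  CliffordAlgebra.contractLeft_algebraMap (Q := (0 : QuadraticForm R (Fin m → R))) δ r

lemma kd_kd (δ : Module.Dual R (Fin m → R)) (x : ExteriorAlgebra R (Fin m → R)) :
    kd δ (kd δ x) = 0 :=
  CliffordAlgebra.contractLeft_contractLeft (Q := (0 : QuadraticForm R (Fin m → R))) δ x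

lemma mem_smul_top_iff (J : Ideal R) (x : ExteriorAlgebra R (Fin m → R)) :
    x ∈ J • (⊤ : Submodule R (ExteriorAlgebra R (Fin m → R))) ↔
      ∀ s, ((Pi.basisFun R (Fin m)).ExteriorAlgebra).repr x s ∈ J := by
  set b := (Pi.basisFun R (Fin m)).ExteriorAlgebra
  constructor
  · intro h s
    refine Submodule.smul_induction_on h ?_ ?_
    · intro r hr y _
      simpa using J.mul_mem_right _ hr
    · intro y z hy hz
      simpa using J.add_mem hy hz
  · intro h
    rw [← b.sum_repr x]
    exact Submodule.sum_mem _ fun s _ => Submodule.smul_mem_smul (h s) trivial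

lemma mul_mem_smul_top (J : Ideal R) (y x : ExteriorAlgebra R (Fin m → R))
    (hx : x ∈ J • (⊤ : Submodule R (ExteriorAlgebra R (Fin m → R)))) :
    y * x ∈ J • (⊤ : Submodule R (ExteriorAlgebra R (Fin m → R))) := by
  refine Submodule.smul_induction_on hx ?_ ?_
  · intro r hr z _
    rw [mul_smul_comm]
    exact Submodule.smul_mem_smul hr trivial
  · intro a b ha hb
    rw [mul_add]
    exact Submodule.add_mem _ ha hb

lemma kd_mem_smul_top (δ : Module.Dual R (Fin m → R)) (J : Ideal R)
    (x : ExteriorAlgebra R (Fin m → R))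
    (hx : x ∈ J • (⊤ : Submodule R (ExteriorAlgebra R (Fin m → R)))) :
    kd δ x ∈ J • (⊤ : Submodule R (ExteriorAlgebra R (Fin m → R))) := by
  refine Submodule.smul_induction_on hx ?_ ?_
  · intro r hr z _
    rw [map_smul]
    exact Submodule.smul_mem_smul hr trivial
  · intro a b ha hb
    rw [map_add]
    exact Submodule.add_mem _ ha hb

/-- The key descent lemma. -/
lemma descent (δ : Module.Dual R (Fin m → R)) {N : ℕ} (Cm : Fin N → (Fin m → R))
    (hreg : ∀ (i : Fin N) (l : List (Fin N)), i ∉ l → ∀ p : R,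
      δ (Cm i) * p ∈ Ideal.span {r | ∃ j ∈ l, r = δ (Cm j)} →
      p ∈ Ideal.span {r | ∃ j ∈ l, r = δ (Cm j)})
    (z : ExteriorAlgebra R (Fin m → R)) (hz : kd δ z = 0) (l : List (Fin N)) (hl : l.Nodup)
    (h : ∃ u, (l.map fun i => ExteriorAlgebra.ι R (Cm i)).prod * z - kd δ u ∈
      (Ideal.span {r | ∃ j ∈ l, r = δ (Cm j)}) •
        (⊤ : Submodule R (ExteriorAlgebra R (Fin m → R)))) :
    ∃ u, z = kd δ u := by
  -- the boundary of the partial products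
  have hb : ∀ l : List (Fin N),
      kd δ ((l.map fun i => ExteriorAlgebra.ι R (Cm i)).prod * z) ∈
        (Ideal.span {r | ∃ j ∈ l, r = δ (Cm j)}) •
        (⊤ : Submodule R (ExteriorAlgebra R (Fin m → R))) := by
    intro l
    induction l with
    | nil => simp [hz]
    | cons i l ih =>
      rw [List.map_cons, List.prod_cons, mul_assoc, kd_ι_mul]
      refine Submodule.sub_mem _ ?_ ?_
      · exact Submodule.smul_mem_smul (Ideal.subset_span ⟨i, by simp, rfl⟩) trivial
      · refine mul_mem_smul_top _ _ _ ?_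
        refine Submodule.smul_mono_left (Ideal.span_mono ?_) ih
        rintro r ⟨j, hj, rfl⟩
        exact ⟨j, by simp [hj], rfl⟩
  induction l with
  | nil =>
    obtain ⟨u, hu⟩ := h
    refine ⟨u, ?_⟩
    simpa [sub_eq_zero] using hu
  | cons i l ih =>
    obtain ⟨hil, hl⟩ := List.nodup_cons.1 hl
    apply ih hl
    obtain ⟨u, hu⟩ := h
    set Z := (l.map fun i => ExteriorAlgebra.ι R (Cm i)).prod * z with hZ
    set J := Ideal.span {r | ∃ j ∈ l, r = δ (Cm j)} with hJ
    have hsp : Ideal.span {r | ∃ j ∈ i :: l, r = δ (Cm j)} = Ideal.span {δ (Cm i)} ⊔ J := by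
      rw [hJ, ← Ideal.span_union]
      congr 1
      ext r
      simp
    rw [List.map_cons, List.prod_cons, mul_assoc, hsp, Submodule.sup_smul] at hu
    obtain ⟨w, hw, t, ht, hwt⟩ := Submodule.mem_sup.1 hu
    rw [Submodule.ideal_span_singleton_smul, Submodule.mem_smul_pointwise_iff_exists] at hw
    obtain ⟨w, -, rfl⟩ := hw
    refine ⟨w, ?_⟩
    have h1 : δ (Cm i) • (Z - kd δ w) ∈
        J • (⊤ : Submodule R (ExteriorAlgebra R (Fin m → R))) := by
      have h2 := congrArg (kd δ) hwt
      rw [map_sub, kd_kd, sub_zero, kd_ι_mul, map_add, map_smul] at h2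
      have h3 : δ (Cm i) • (Z - kd δ w) = kd δ t + ExteriorAlgebra.ι R (Cm i) * kd δ Z := by
        rw [smul_sub]
        rw [eq_sub_iff_add_eq] at h2
        rw [← h2]; abel
      rw [h3]
      exact Submodule.add_mem _ (kd_mem_smul_top _ _ _ ht) (mul_mem_smul_top _ _ _ (hb l))
    rw [mem_smul_top_iff] at h1 ⊢
    intro s
    have := h1 s
    rw [map_smul, Finsupp.smul_apply, smul_eq_mul] at this
    exact hreg i l hil _ this

/-- Projection onto degrees zero and one of the exterior algebra. -/
def low : ExteriorAlgebra R (Fin m → R) →ₐ[R] TrivSqZeroExt R (Fin m → R) :=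
  ExteriorAlgebra.toTrivSqZeroExt

lemma low_ι (a : Fin m → R) : low (ExteriorAlgebra.ι R a) = TrivSqZeroExt.inr a :=
  ExteriorAlgebra.toTrivSqZeroExt_ι _

lemma low_kd_fst (δ : Module.Dual R (Fin m → R)) (x : ExteriorAlgebra R (Fin m → R)) :
    (low (kd δ x)).fst = δ (low x).snd := by
  induction x using CliffordAlgebra.left_induction with
  | algebraMap r =>
    have h := kd_algebraMap δ r
    change (low (kd δ (algebraMap R (ExteriorAlgebra R (Fin m → R)) r))).fst =
      δ (low (algebraMap R (ExteriorAlgebra R (Fin m → R)) r)).snd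
    rw [h, map_zero, AlgHom.commutes]
    simp [TrivSqZeroExt.algebraMap_eq_inl]
  | add x y hx hy => simp only [map_add, TrivSqZeroExt.fst_add, TrivSqZeroExt.snd_add, hx, hy]
  | ι_mul x a hx =>
    change (low (kd δ (ExteriorAlgebra.ι R a * x))).fst = δ (low (ExteriorAlgebra.ι R a * x)).snd
    rw [kd_ι_mul, map_sub, map_smul, map_mul, map_mul, low_ι]
    simp [mul_comm]

lemma low_kd_snd (δ : Module.Dual R (Fin m → R)) (P : Submodule R (Fin m → R))
    (hP : ∀ a w, δ a • w - δ w • a ∈ P) (x : ExteriorAlgebra R (Fin m → R)) :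
    (low (kd δ x)).snd ∈ P := by
  induction x using CliffordAlgebra.left_induction with
  | algebraMap r =>
    have h := kd_algebraMap δ r
    change (low (kd δ (algebraMap R (ExteriorAlgebra R (Fin m → R)) r))).snd ∈ P
    rw [h, map_zero]
    simp
  | add x y hx hy => 
    simp only [map_add, TrivSqZeroExt.snd_add]
    exact P.add_mem hx hy
  | ι_mul x a hx =>
    change (low (kd δ (ExteriorAlgebra.ι R a * x))).snd ∈ P
    rw [kd_ι_mul, map_sub, map_smul, map_mul, low_ι]
    have := hP a (low x).snd
    rw [← low_kd_fst] at this
    simpa using this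

lemma ιMulti_eq_det (B : Fin m → Fin m → R) :
    ExteriorAlgebra.ιMulti R m B =
      (Matrix.of B).det • ExteriorAlgebra.ιMulti R m (fun i => Pi.basisFun R (Fin m) i) := by
  have : ExteriorAlgebra.ιMulti R m = (LinearMap.toSpanSingleton R _
      (ExteriorAlgebra.ιMulti R m (fun i => Pi.basisFun R (Fin m) i))).compAlternatingMap
        (Pi.basisFun R (Fin m)).det := by
    refine Module.Basis.ext_alternating (Pi.basisFun R (Fin m)) fun i h => ?_
    let σ : Equiv.Perm (Fin m) := Equiv.ofBijective i (Finite.injective_iff_bijective.1 h)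
    change ExteriorAlgebra.ιMulti R m ((fun i => Pi.basisFun R (Fin m) i) ∘ σ) =
      ((LinearMap.toSpanSingleton R _
      (ExteriorAlgebra.ιMulti R m (fun i => Pi.basisFun R (Fin m) i))).compAlternatingMap
        (Pi.basisFun R (Fin m)).det) ((fun i => Pi.basisFun R (Fin m) i) ∘ σ)
    rw [AlternatingMap.map_perm, AlternatingMap.map_perm]
    congr 1
    rw [LinearMap.compAlternatingMap_apply, Module.Basis.det_self,
      LinearMap.toSpanSingleton_apply, one_smul]
  have h2 := congrArg (fun F => F B) this
  rw [LinearMap.compAlternatingMap_apply, Pi.basisFun_det, LinearMap.toSpanSingleton_apply] at h2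
  exact h2

/-- descent, degree zero version for square matrices -/
lemma det_not_mem {N : ℕ} (f : Fin N → R) (U : Fin N → Fin N → R) (g : Fin N → R)
    (hg : ∀ i, U i ⬝ᵥ f = g i)
    (hreg : ∀ (i : Fin N) (l : List (Fin N)), i ∉ l → ∀ p : R,
      g i * p ∈ Ideal.span {r | ∃ j ∈ l, r = g j} →
      p ∈ Ideal.span {r | ∃ j ∈ l, r = g j})
    (h : (Matrix.of U).det ∈ Ideal.span (Set.range g)) :
    (1 : R) ∈ Ideal.span (Set.range f) := by
  let δ : Module.Dual R (Fin N → R) := (dotProductBilin R R).flip f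
  have hδ : ∀ a, δ a = a ⬝ᵥ f := fun a => rfl
  obtain ⟨u, hu⟩ := descent δ U (by simpa only [hδ, hg] using hreg) 1 (kd_one δ) (List.finRange N)
    (List.nodup_finRange N) ⟨0, by
      have h1 : ((List.finRange N).map fun i => ExteriorAlgebra.ι R (U i)).prod =
          ExteriorAlgebra.ιMulti R N U := by
        rw [ExteriorAlgebra.ιMulti_apply, List.ofFn_eq_map]
      rw [h1, ιMulti_eq_det, map_zero, sub_zero, mul_one]
      refine Submodule.smul_mem_smul ?_ trivial
      convert h using 2
      ext r
      simp [hδ, hg, eq_comm]⟩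
  have := low_kd_fst δ u
  rw [← hu, map_one, TrivSqZeroExt.fst_one, hδ] at this
  rw [this, dotProduct]
  exact Ideal.sum_mem _ fun i _ => Ideal.mul_mem_left _ _ (Ideal.subset_span ⟨i, rfl⟩)

/-- descent, degree one version -/
lemma syz_koszul {N : ℕ} (f : Fin (N + 1) → R) (v : Fin (N + 1) → R) (hv : v ⬝ᵥ f = 0)
    (U : Fin N → Fin (N + 1) → R) (g : Fin N → R)
    (hg : ∀ i, U i ⬝ᵥ f = g i)
    (hreg : ∀ (i : Fin N) (l : List (Fin N)), i ∉ l → ∀ p : R,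
      g i * p ∈ Ideal.span {r | ∃ j ∈ l, r = g j} →
      p ∈ Ideal.span {r | ∃ j ∈ l, r = g j})
    (h : (Matrix.of (Fin.cons v U : Fin (N + 1) → Fin (N + 1) → R)).det ∈
      Ideal.span (Set.range g))
    (P : Submodule R (Fin (N + 1) → R))
    (hP : ∀ a w, (a ⬝ᵥ f) • w - (w ⬝ᵥ f) • a ∈ P) : v ∈ P := by
  let δ : Module.Dual R (Fin (N + 1) → R) := (dotProductBilin R R).flip f
  have hδ : ∀ a, δ a = a ⬝ᵥ f := fun a => rfl
  obtain ⟨u, hu⟩ := descent δ U (by simpa only [hδ, hg] using hreg) (ExteriorAlgebra.ι R v)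
    (by rw [kd_ι, hδ, hv, map_zero]) (List.finRange N)
    (List.nodup_finRange N) ⟨0, by
      have h1 : ((List.finRange N).map fun i => ExteriorAlgebra.ι R (U i)).prod *
          ExteriorAlgebra.ι R v = ExteriorAlgebra.ιMulti R (N + 1)
            (Fin.snoc U v : Fin (N + 1) → Fin (N + 1) → R) := by
        rw [ExteriorAlgebra.ιMulti_apply, List.ofFn_succ', List.concat_eq_append,
          List.prod_append, List.ofFn_eq_map]
        simp
      have h2 : (Matrix.of (Fin.snoc U v : Fin (N + 1) → Fin (N + 1) → R)) =
          (Matrix.of (Fin.cons v U : Fin (N + 1) → Fin (N + 1) → R)).submatrix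
            (finRotate _) id := by
        have h3 : (Fin.snoc U v : Fin (N + 1) → Fin (N + 1) → R) =
          fun i => (Fin.cons v U : Fin (N + 1) → Fin (N + 1) → R) (finRotate _ i) :=
            Fin.snoc_eq_cons_rotate _ _
        rw [h3]
        rfl
      rw [h1, ιMulti_eq_det, map_zero, sub_zero, h2, Matrix.det_permute]
      refine Submodule.smul_mem_smul (Ideal.mul_mem_left _ _ ?_) trivial
      convert h using 2
      ext r
      simp [hδ, hg, eq_comm]⟩
  have := low_kd_snd δ P hP u
  rwa [← hu, low_ι, TrivSqZeroExt.snd_inr] at this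

end Ext


section Mat
variable {R : Type*} [CommRing R] {N : ℕ}

lemma det_cons_row (v : Fin (N + 1) → R) (U : Fin N → Fin (N + 1) → R) :
    (Matrix.of (Fin.cons v U : Fin (N + 1) → Fin (N + 1) → R)).det =
      ∑ i : Fin (N + 1), (-1) ^ (i : ℕ) * v i * ((Matrix.of U).submatrix id i.succAbove).det := by
  rw [Matrix.det_succ_row_zero]
  rfl

/-- signed maximal minors -/
def sminor (A : Matrix (Fin (N + 1)) (Fin N) R) (i : Fin (N + 1)) : R :=
  (-1) ^ (i : ℕ) * (A.submatrix i.succAbove id).det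

lemma det_cons_col (w : Fin (N + 1) → R) (A : Matrix (Fin (N + 1)) (Fin N) R) :
    (Matrix.of (fun i => (Fin.cons (w i) (A i) : Fin (N + 1) → R))).det =
      ∑ i, sminor A i * w i := by
  rw [Matrix.det_succ_column_zero]
  refine Finset.sum_congr rfl fun i _ => ?_
  rw [sminor, mul_right_comm]
  rfl

lemma sminor_mul_col (A : Matrix (Fin (N + 1)) (Fin N) R) (c : Fin N) :
    ∑ i, sminor A i * A i c = 0 := by
  rw [← det_cons_col (fun i => A i c) A]
  refine Matrix.det_zero_of_column_eq (i := 0) (j := c.succ) (Fin.succ_ne_zero c).symm ?_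
  intro k
  simp

lemma cb_aux (U : Matrix (Fin N) (Fin (N + 1)) R) (A : Matrix (Fin (N + 1)) (Fin N) R)
    (w : Fin (N + 1) → R) :
    (Matrix.of (Fin.cons (sminor A) U : Fin (N + 1) → Fin (N + 1) → R)).det *
      (∑ i, sminor A i * w i) = (∑ i, sminor A i * w i) * (U * A).det := by
  rw [← det_cons_col, ← Matrix.det_mul, Matrix.det_succ_row_zero, Fin.sum_univ_succ]
  rw [Finset.sum_eq_zero, add_zero, det_cons_col]
  · simp only [Fin.val_zero, pow_zero, one_mul, Matrix.mul_apply, Matrix.of_apply, Fin.cons_zero]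
    rfl
  · intro c _
    have : (Matrix.of (Fin.cons (sminor A) U : Fin (N + 1) → Fin (N + 1) → R) *
      Matrix.of (fun i => (Fin.cons (w i) (A i) : Fin (N + 1) → R))) 0 c.succ = 0 := by
      simp only [Matrix.mul_apply, Matrix.of_apply, Fin.cons_zero, Fin.cons_succ]
      exact sminor_mul_col A c
    rw [this]
    ring

lemma sminor_map {R' : Type*} [CommRing R'] (φ : R →+* R') (A : Matrix (Fin (N + 1)) (Fin N) R)
    (i : Fin (N + 1)) : φ (sminor A i) = sminor (A.map φ) i := by
  rw [sminor, sminor, map_mul, RingHom.map_det, map_pow, map_neg, map_one]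
  rfl

lemma cons_map {R' : Type*} [CommRing R'] (φ : R →+* R') (v : Fin (N + 1) → R)
    (U : Fin N → Fin (N + 1) → R) :
    φ (Matrix.of (Fin.cons v U : Fin (N + 1) → Fin (N + 1) → R)).det =
    (Matrix.of (Fin.cons (fun i => φ (v i)) (fun r i => φ (U r i)) :
      Fin (N + 1) → Fin (N + 1) → R')).det := by
  rw [RingHom.map_det]
  congr 1
  ext i j
  refine Fin.cases ?_ (fun i => ?_) i <;> simp

/-- Cauchy-Binet for `N × (N+1)` times `(N+1) × N`. -/
lemma cauchy_binet (U : Matrix (Fin N) (Fin (N + 1)) R) (A : Matrix (Fin (N + 1)) (Fin N) R) :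
    (Matrix.of (Fin.cons (sminor A) U : Fin (N + 1) → Fin (N + 1) → R)).det = (U * A).det := by
  let A' : Matrix (Fin (N + 1)) (Fin N) (Polynomial R) :=
    Matrix.of (Fin.cons (fun c => Polynomial.C (A 0 c))
      (fun i j => Matrix.charmatrix (-(A.submatrix Fin.succ id)) i j) :
        Fin (N + 1) → Fin N → Polynomial R)
  let U' : Matrix (Fin N) (Fin (N + 1)) (Polynomial R) := U.map Polynomial.C
  have h := cb_aux U' A' (Pi.single 0 1)
  have h0 : ∑ i, sminor A' i * (Pi.single 0 1 : Fin (N + 1) → Polynomial R) i =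
      (-(A.submatrix Fin.succ id)).charpoly := by
    rw [Finset.sum_eq_single 0]
    · simp only [sminor, Fin.val_zero, pow_zero, one_mul, Pi.single_eq_same, mul_one,
        Matrix.charpoly]
      rfl
    · intro b _ hb
      simp [hb]
    · simp
  rw [h0, mul_comm] at h
  have h1 := (Matrix.charpoly_monic (-(A.submatrix Fin.succ id))).isRegular.left h
  have h2 := congrArg (Polynomial.evalRingHom 0) h1
  have hA : A'.map (Polynomial.evalRingHom 0) = A := by
    ext i j
    refine Fin.cases ?_ (fun i => ?_) i
    · simp [A']
    · simp [A', Matrix.charmatrix_apply, Matrix.diagonal_apply, apply_ite (Polynomial.eval (0 : R))]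
  have hU : U'.map (Polynomial.evalRingHom 0) = U := by
    ext i j
    simp [U']
  rw [RingHom.map_det (Polynomial.evalRingHom 0) (U' * A'), RingHom.mapMatrix_apply,
    Matrix.map_mul, hA, hU] at h2
  erw [cons_map] at h2
  rw [← h2]
  congr 3
  · funext i
    rw [sminor_map, hA]
  · funext i j
    simp [U']

lemma cramer_mem {M : ℕ} (B : Matrix (Fin M) (Fin M) R) (w : Fin M → R) (j : Fin M) :
    B.det * w j = ∑ l, B.adjugate j l * (B.mulVec w) l := by
  have h := congrFun (congrArg (fun C : Matrix (Fin M) (Fin M) R => C.mulVec w)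
    (Matrix.adjugate_mul B)) j
  simp only [← Matrix.mulVec_mulVec] at h
  rw [Matrix.smul_mulVec, Matrix.one_mulVec, Pi.smul_apply, smul_eq_mul] at h
  rw [← h]
  rfl

variable (f : Fin (N + 1) → R) (U : Fin N → Fin (N + 1) → R) (g : Fin N → R)
    (hg : ∀ i, U i ⬝ᵥ f = g i)
include hg

lemma cons_cramer (v : Fin (N + 1) → R) (j : Fin (N + 1)) :
    (Matrix.of (Fin.cons v U : Fin (N + 1) → Fin (N + 1) → R)).det * f j -
      (Matrix.of (Fin.cons (Pi.single j 1) U : Fin (N + 1) → Fin (N + 1) → R)).det * (v ⬝ᵥ f) ∈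
        Ideal.span (Set.range g) := by
  rw [cramer_mem, Fin.sum_univ_succ]
  have h0 : ((Matrix.of (Fin.cons v U : Fin (N + 1) → Fin (N + 1) → R)).mulVec f) 0 = v ⬝ᵥ f := by
    simp [Matrix.mulVec]
  have h1 : (Matrix.of (Fin.cons v U : Fin (N + 1) → Fin (N + 1) → R)).adjugate j 0 =
    (Matrix.of (Fin.cons (Pi.single j 1) U : Fin (N + 1) → Fin (N + 1) → R)).det := by
    rw [Matrix.adjugate_apply]
    congr 1
    ext a b
    refine Fin.cases ?_ (fun a => ?_) a
    · simp
    · simp [Matrix.updateRow_ne]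
  rw [h0, h1, add_sub_cancel_left]
  refine Ideal.sum_mem _ fun i _ => Ideal.mul_mem_left _ _ (Ideal.subset_span ⟨i, ?_⟩)
  rw [← hg]
  simp [Matrix.mulVec]

lemma cons_mul_mem (v : Fin (N + 1) → R) (hv : v ⬝ᵥ f = 0) (j : Fin (N + 1)) :
    (Matrix.of (Fin.cons v U : Fin (N + 1) → Fin (N + 1) → R)).det * f j ∈
        Ideal.span (Set.range g) := by
  simpa [hv] using cons_cramer f U g hg v j

lemma cons_kosz_mem (p : R) (i j : Fin (N + 1)) (hij : i ≠ j) (v : Fin (N + 1) → R)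
    (hv : ∀ t, v t = p * (if t = i then f j else if t = j then -f i else 0)) :
    (Matrix.of (Fin.cons v U : Fin (N + 1) → Fin (N + 1) → R)).det ∈
        Ideal.span (Set.range g) := by
  have h := cons_cramer f U g hg (Pi.single i 1) j
  have h2 := Ideal.mul_mem_left _ p h
  convert h2 using 1
  simp only [det_cons_row, hv]
  have e : ∀ (t : Fin (N + 1)) (M : R), (-1) ^ (t : ℕ) * (p * (if t = i then f j else if t = j then -f i else 0)) * M
    = p * ((-1) ^ (t : ℕ) * (Pi.single i 1 : Fin (N + 1) → R) t * M * f j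
      - (-1) ^ (t : ℕ) * (Pi.single j 1 : Fin (N + 1) → R) t * M * f i) := by
    intro t M
    by_cases h1 : t = i
    · subst h1
      simp [hij]; ring
    · by_cases h2 : t = j
      · subst h2
        simp [h1]; ring
      · simp [h1, h2]
  simp only [e, ← Finset.mul_sum, Finset.sum_sub_distrib, ← Finset.sum_mul]
  simp

end Mat

section Mono
variable {k : Type*} [Field k] {N : ℕ}

lemma mem_span_pow_iff (s : ℕ) (T : Set (Fin N)) (p : MvPolynomial (Fin N) k) :
    p ∈ Ideal.span {r | ∃ j ∈ T, r = (X j : MvPolynomial (Fin N) k) ^ s} ↔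
      ∀ m ∈ p.support, ∃ j ∈ T, s ≤ m j := by
  have : {r | ∃ j ∈ T, r = (X j : MvPolynomial (Fin N) k) ^ s} =
    (fun s => monomial s (1 : k)) '' ((fun j => Finsupp.single j s) '' T) := by
    ext r
    simp only [Set.mem_ofPred_eq, Set.image_image, Set.mem_image, X_pow_eq_monomial]
    exact exists_congr fun j => and_congr_right fun _ => eq_comm
  rw [this, mem_ideal_span_monomial_image]
  simp

lemma mem_span_range_iff (s : ℕ) (p : MvPolynomial (Fin N) k) :
    p ∈ Ideal.span (Set.range fun j => (X j : MvPolynomial (Fin N) k) ^ s) ↔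
      ∀ m ∈ p.support, ∃ j, s ≤ m j := by
  have := mem_span_pow_iff s Set.univ p
  simp only [Set.mem_univ, true_and] at this
  rw [← this]
  congr! 3
  ext r
  simp [eq_comm]

lemma pow_reg (s : ℕ) (i : Fin N) (l : List (Fin N)) (hi : i ∉ l) (p : MvPolynomial (Fin N) k)
    (h : (X i : MvPolynomial (Fin N) k) ^ s * p ∈
      Ideal.span {r | ∃ j ∈ l, r = (X j : MvPolynomial (Fin N) k) ^ s}) :
    p ∈ Ideal.span {r | ∃ j ∈ l, r = (X j : MvPolynomial (Fin N) k) ^ s} := by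
  have e := mem_span_pow_iff (k := k) s {j | j ∈ l}
  simp only [Set.mem_ofPred_eq] at e
  rw [e] at h ⊢
  intro m hm
  obtain ⟨j, hj, hjm⟩ := h (Finsupp.single i s + m) (by
    rw [mem_support_iff, X_pow_eq_monomial, coeff_monomial_mul, one_mul]
    exact mem_support_iff.1 hm)
  refine ⟨j, hj, ?_⟩
  have : i ≠ j := fun h => hi (h ▸ hj)
  simpa [Finsupp.single_apply, this] using hjm

lemma hom_sum {p : MvPolynomial (Fin N) k} {e : ℕ} (hp : p.IsHomogeneous e) {m : Fin N →₀ ℕ}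
    (hm : coeff m p ≠ 0) : ∑ j, m j = e := by
  have h3 := hp hm
  rw [← h3]
  simp [Finsupp.weight_apply, Finsupp.sum_fintype]

lemma hom_of_sum {p : MvPolynomial (Fin N) k} {e : ℕ}
    (h : ∀ m : Fin N →₀ ℕ, coeff m p ≠ 0 → ∑ j, m j = e) : p.IsHomogeneous e := by
  intro m hm
  rw [← h m hm]
  simp [Finsupp.weight_apply, Finsupp.sum_fintype]

/-- A form of degree `N (s-1)` only has monomials in `(x^s)` and the top one. -/
lemma top_coeff (s : ℕ) (p : MvPolynomial (Fin N) k) (m : Fin N →₀ ℕ)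
    (hm : m ∈ p.support) (hp : p.IsHomogeneous (N * (s - 1))) :
    (∃ j, s ≤ m j) ∨ m = Finsupp.equivFunOnFinite.symm fun _ => s - 1 := by
  by_contra! h
  obtain ⟨h1, h2⟩ := h
  have h3 := hom_sum hp (mem_support_iff.1 hm)
  apply h2
  have h4 : ∀ j ∈ Finset.univ, m j ≤ s - 1 := fun j _ => Nat.le_sub_one_of_lt (h1 j)
  have h5 : ∑ j, m j = ∑ j : Fin N, (s - 1) := by simp [h3]
  ext j
  exact (Finset.sum_eq_sum_iff_of_le h4).1 h5 j (Finset.mem_univ j)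

end Mono


section TT
variable {k : Type*} [Field k] {N : ℕ}

/-- bihomogeneity (total degree `e`) in the iterated polynomial ring -/
def TH (e : ℕ) (Q : MvPolynomial (Fin N) (MvPolynomial (Fin N) k)) : Prop :=
  ∀ α β, coeff β (coeff α Q) ≠ 0 → ∑ j, α j + ∑ j, β j = e

lemma TH.add {e : ℕ} {P Q : MvPolynomial (Fin N) (MvPolynomial (Fin N) k)} (hP : TH e P)
    (hQ : TH e Q) : TH e (P + Q) := by
  intro α β h
  rw [coeff_add, coeff_add] at h
  by_cases h1 : coeff β (coeff α P) = 0
  · rw [h1, zero_add] at h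
    exact hQ α β h
  · exact hP α β h1

lemma TH.zero {e : ℕ} : TH e (0 : MvPolynomial (Fin N) (MvPolynomial (Fin N) k)) := by
  intro α β h
  simp at h

lemma TH.mul {e e' : ℕ} {P Q : MvPolynomial (Fin N) (MvPolynomial (Fin N) k)} (hP : TH e P)
    (hQ : TH e' Q) : TH (e + e') (P * Q) := by
  intro α β h
  rw [coeff_mul, coeff_sum] at h
  obtain ⟨⟨a, b⟩, hab, h⟩ := Finset.exists_ne_zero_of_sum_ne_zero h
  rw [coeff_mul] at h
  obtain ⟨⟨a', b'⟩, hab', h⟩ := Finset.exists_ne_zero_of_sum_ne_zero h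
  rw [Finset.HasAntidiagonal.mem_antidiagonal] at hab hab'
  rw [← hP a a' (left_ne_zero_of_mul h), ← hQ b b' (right_ne_zero_of_mul h), ← hab, ← hab']
  simp only [Finsupp.add_apply, Finset.sum_add_distrib]
  ring

lemma TH.sum {e : ℕ} {ι : Type*} (s : Finset ι)
    (P : ι → MvPolynomial (Fin N) (MvPolynomial (Fin N) k)) (h : ∀ i ∈ s, TH e (P i)) :
    TH e (∑ i ∈ s, P i) :=
  Finset.sum_induction P (TH e) (fun _ _ => TH.add) TH.zero h

lemma TH.C {e : ℕ} {p : MvPolynomial (Fin N) k} (hp : p.IsHomogeneous e) :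
    TH e (MvPolynomial.C p) := by
  intro α β h
  rw [coeff_C] at h
  split_ifs at h with h0
  · subst h0
    simpa using hom_sum hp h
  · simp at h

lemma TH.one : TH 0 (1 : MvPolynomial (Fin N) (MvPolynomial (Fin N) k)) := by
  have := TH.C (isHomogeneous_one (Fin N) k)
  simpa using this

lemma TH.map {e : ℕ} {p : MvPolynomial (Fin N) k} (hp : p.IsHomogeneous e) :
    TH e (MvPolynomial.map (MvPolynomial.C : k →+* MvPolynomial (Fin N) k) p) := by
  intro α β h
  rw [coeff_map, coeff_C] at h
  split_ifs at h with h0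
  · subst h0
    simpa using hom_sum hp h
  · simp at h

lemma TH.prod {ι : Type*} (s : Finset ι) (e : ι → ℕ)
    (P : ι → MvPolynomial (Fin N) (MvPolynomial (Fin N) k)) (h : ∀ i ∈ s, TH (e i) (P i)) :
    TH (∑ i ∈ s, e i) (∏ i ∈ s, P i) := by
  classical
  induction s using Finset.induction_on with
  | empty => simpa using TH.one
  | insert a s ha ih =>
    rw [Finset.sum_insert ha, Finset.prod_insert ha]
    exact TH.mul (h a (by simp)) (ih fun i hi => h i (by simp [hi]))

lemma TH.neg {e : ℕ} {P : MvPolynomial (Fin N) (MvPolynomial (Fin N) k)} (hP : TH e P) :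
    TH e (-P) := by
  intro α β h
  exact hP α β (by simpa using h)

lemma TH.pow {e : ℕ} {P : MvPolynomial (Fin N) (MvPolynomial (Fin N) k)} (hP : TH e P) (a : ℕ) :
    TH (a * e) (P ^ a) := by
  have := TH.prod (Finset.range a) (fun _ => e) (fun _ => P) (fun _ _ => hP)
  simpa using this

lemma TH.det {e M : ℕ} (B : Matrix (Fin M) (Fin M) (MvPolynomial (Fin N) (MvPolynomial (Fin N) k)))
    (h : ∀ i j, TH e (B i j)) : TH (M * e) B.det := by
  rw [Matrix.det_apply]
  refine TH.sum _ _ fun σ _ => ?_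
  have := TH.prod Finset.univ (fun _ : Fin M => e) (fun i => B (σ i) i) (fun i _ => h _ _)
  simp only [Finset.sum_const, Finset.card_univ, Fintype.card_fin, smul_eq_mul] at this
  rcases Int.units_eq_one_or (Equiv.Perm.sign σ) with h | h
  · simpa [h] using this
  · simpa [h] using this.neg

lemma TH.coeff_hom {e : ℕ} {P : MvPolynomial (Fin N) (MvPolynomial (Fin N) k)} (hP : TH e P)
    (α : Fin N →₀ ℕ) : (MvPolynomial.coeff α P).IsHomogeneous (e - ∑ j, α j) := by
  refine hom_of_sum fun m hm => ?_
  have := hP α m hm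
  omega

/-- homogeneity of determinants -/
lemma hom_det {e M : ℕ} (B : Matrix (Fin M) (Fin M) (MvPolynomial (Fin N) k))
    (h : ∀ i j, (B i j).IsHomogeneous e) : B.det.IsHomogeneous (M * e) := by
  rw [Matrix.det_apply]
  refine IsHomogeneous.sum _ _ _ fun σ _ => ?_
  have := IsHomogeneous.prod Finset.univ (fun i => B (σ i) i) (fun _ : Fin M => e)
    (fun i _ => h _ _)
  simp only [Finset.sum_const, Finset.card_univ, Fintype.card_fin, smul_eq_mul] at this
  rcases Int.units_eq_one_or (Equiv.Perm.sign σ) with h | h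
  · simpa [h] using this
  · simpa [h] using this.neg

end TT

lemma hc_mul {k σ : Type*} [Field k] {e : ℕ} {l : MvPolynomial σ k} (hl : l.IsHomogeneous e)
    (m : ℕ) (P : MvPolynomial σ k) : homogeneousComponent m (P * l) =
      if e ≤ m then homogeneousComponent (m - e) P * l else 0 := by
  conv_lhs => rw [← sum_homogeneousComponent P, Finset.sum_mul, map_sum]
  have h1 : ∀ i, homogeneousComponent m (homogeneousComponent i P * l) =
      if m = i + e then homogeneousComponent i P * l else 0 := by
    intro i
    rw [homogeneousComponent_of_mem ((homogeneousComponent_isHomogeneous i P).mul hl)]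
  simp only [h1]
  split_ifs with h
  · by_cases h2 : m - e < P.totalDegree + 1
    · rw [Finset.sum_eq_single (m - e)]
      · rw [if_pos (by omega)]
      · intro b _ hb
        rw [if_neg (by omega)]
      · intro hb
        exact absurd (Finset.mem_range.2 h2) hb
    · rw [homogeneousComponent_eq_zero _ _ (by omega), zero_mul]
      refine Finset.sum_eq_zero fun i hi => ?_
      rw [Finset.mem_range] at hi
      rw [if_neg (by omega)]
  · refine Finset.sum_eq_zero fun i hi => ?_
    rw [if_neg (by omega)]

section Div
variable (k : Type*) [Field k] (n : ℕ)

/-- The identification of `k[x,y]` with `k[x][y]`. -/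
def tau : MvPolynomial (Fin (n + 1) ⊕ Fin (n + 1)) k →ₐ[k]
    MvPolynomial (Fin (n + 1)) (MvPolynomial (Fin (n + 1)) k) :=
  (sumAlgEquiv k (Fin (n + 1)) (Fin (n + 1))).toAlgHom.comp (rename Sum.swap)

lemma tau_inl (i) : tau k n (X (Sum.inl i)) = C (X i) := by
  simp [tau]

lemma tau_inr (i) : tau k n (X (Sum.inr i)) = X i := by
  simp [tau]

lemma coeffY_eq (Q α) : coeffY k n Q α = coeff α (tau k n Q) := rfl

lemma tau_TH {e : ℕ} {Q : MvPolynomial (Fin (n + 1) ⊕ Fin (n + 1)) k} (hQ : Q.IsHomogeneous e) :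
    TH e (tau k n Q) := by
  rw [Q.as_sum, map_sum]
  refine TH.sum _ _ fun γ hγ => ?_
  have h := hQ (mem_support_iff.1 hγ)
  rw [monomial_eq, map_mul, Finsupp.prod_fintype _ _ (by simp), map_prod]
  have h1 : TH 0 (tau k n (C (coeff γ Q))) := by
    have : tau k n (C (coeff γ Q)) = C (C (coeff γ Q)) := by simp [tau]
    rw [this]
    exact TH.C (isHomogeneous_C _ _)
  have h2 := TH.prod Finset.univ (fun i => γ i * 1) (fun i => tau k n (X i ^ γ i)) (by
    intro i _
    rw [map_pow]
    apply TH.pow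
    rcases i with i | i
    · rw [tau_inl]
      exact TH.C (isHomogeneous_X _ _)
    · rw [tau_inr]
      simpa using TH.map (isHomogeneous_X k i))
  have h3 := h1.mul h2
  convert h3 using 1
  rw [← h]
  simp [Finsupp.weight_apply, Finsupp.sum_fintype]

lemma tau_mixv_zero (f : MvPolynomial (Fin (n + 1)) k) :
    tau k n (aeval (mixv k n 0) f) = C f := by
  have : (tau k n).comp (aeval (mixv k n 0)) =
      IsScalarTower.toAlgHom k (MvPolynomial (Fin (n + 1)) k)
        (MvPolynomial (Fin (n + 1)) (MvPolynomial (Fin (n + 1)) k)) := by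
    apply MvPolynomial.algHom_ext
    intro i
    simp [mixv, tau_inl]
  exact DFunLike.congr_fun this f

lemma tau_mixv_top (f : MvPolynomial (Fin (n + 1)) k) :
    tau k n (aeval (mixv k n (n + 1)) f) = map C f := by
  have : (tau k n).comp (aeval (mixv k n (n + 1))) =
      (mapAlgHom (Algebra.ofId k (MvPolynomial (Fin (n + 1)) k))) := by
    apply MvPolynomial.algHom_ext
    intro i
    have : mixv k n (n + 1) i = X (Sum.inr i) := if_pos i.isLt
    simp [this, tau_inr]
  exact DFunLike.congr_fun this f

lemma mixv_hom {f : MvPolynomial (Fin (n + 1)) k} {d : ℕ} (hf : f.IsHomogeneous d) (j : ℕ) :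
    (aeval (mixv k n j) f).IsHomogeneous d := by
  have := hf.aeval (mixv k n j) (n := 1) (by
    intro i
    rw [mixv]
    split_ifs <;> exact isHomogeneous_X _ _)
  simpa using this

lemma sub_ne (j : Fin (n + 1)) :
    (X (Sum.inl j) - X (Sum.inr j) : MvPolynomial (Fin (n + 1) ⊕ Fin (n + 1)) k) ≠ 0 := by
  rw [sub_ne_zero]
  intro h
  have := X_injective h
  simp at this

lemma divdiff_unique {f : MvPolynomial (Fin (n + 1)) k} {j : Fin (n + 1)} {P Q}
    (hP : IsDivDiff k n f j P) (hQ : IsDivDiff k n f j Q) : P = Q :=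
  mul_right_cancel₀ (sub_ne k n j) (hP.trans hQ.symm)

lemma divdiff_hom {f : MvPolynomial (Fin (n + 1)) k} {d : ℕ} (hd : 1 ≤ d) (hf : f.IsHomogeneous d)
    {j : Fin (n + 1)} {P} (hP : IsDivDiff k n f j P) : P.IsHomogeneous (d - 1) := by
  have hl : (X (Sum.inl j) - X (Sum.inr j) :
      MvPolynomial (Fin (n + 1) ⊕ Fin (n + 1)) k).IsHomogeneous 1 :=
    (isHomogeneous_X _ _).sub (isHomogeneous_X _ _)
  have hF := (mixv_hom k n hf j).sub (mixv_hom k n hf (j + 1))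
  rw [IsDivDiff] at hP
  rw [← hP] at hF
  have key : ∀ m, m ≠ d - 1 → homogeneousComponent m P = 0 := by
    intro m hm
    have h1 : homogeneousComponent (m + 1) (P * (X (Sum.inl j) - X (Sum.inr j))) =
        homogeneousComponent m P * (X (Sum.inl j) - X (Sum.inr j)) := by
      rw [hc_mul hl, if_pos (by omega), Nat.add_sub_cancel]
    rw [homogeneousComponent_of_mem hF, if_neg (by omega)] at h1
    exact (mul_eq_zero.1 h1.symm).resolve_right (sub_ne k n j)
  rw [← sum_homogeneousComponent P]
  refine IsHomogeneous.sum _ _ _ fun m _ => ?_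
  by_cases hm : m = d - 1
  · rw [hm]; exact homogeneousComponent_isHomogeneous _ _
  · rw [key m hm]; exact isHomogeneous_zero _ _ _

lemma exists_A {d : ℕ} (hd : 1 ≤ d)
    (f : Fin (n + 2) → MvPolynomial (Fin (n + 1)) k)
    (hf : ∀ i, (f i).IsHomogeneous d)
    (D : Fin (n + 2) →
      Matrix (Fin (n + 1)) (Fin (n + 1)) (MvPolynomial (Fin (n + 1) ⊕ Fin (n + 1)) k))
    (hD : ∀ (i : Fin (n + 2)) (r c : Fin (n + 1)),
      IsDivDiff k n (f (i.succAbove r)) c (D i r c)) :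
    ∃ A : Matrix (Fin (n + 2)) (Fin (n + 1))
        (MvPolynomial (Fin (n + 1)) (MvPolynomial (Fin (n + 1)) k)),
      (∀ i α, coeffY k n (D i).det α = coeff α (A.submatrix i.succAbove id).det) ∧
      (∀ t, ∑ c, A t c * (C (X c) - X c) = C (f t) - map C (f t)) ∧
      (∀ t c, TH (d - 1) (A t c)) := by
  have hex : ∀ t : Fin (n + 2), ∃ (i : Fin (n + 2)) (r : Fin (n + 1)), i.succAbove r = t := by
    intro t
    obtain ⟨i, hi⟩ := exists_ne t
    obtain ⟨r, hr⟩ := Fin.exists_succAbove_eq hi.symm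
    exact ⟨i, r, hr⟩
  choose i0 r0 h0 using hex
  have hB : ∀ t c, IsDivDiff k n (f t) c (D (i0 t) (r0 t) c) := by
    intro t c
    have := hD (i0 t) (r0 t) c
    rwa [h0] at this
  refine ⟨Matrix.of fun t c => tau k n (D (i0 t) (r0 t) c), ?_, ?_, ?_⟩
  · intro i α
    rw [coeffY_eq, AlgHom.map_det]
    congr 2
    ext1 r c
    simp only [AlgHom.mapMatrix_apply, Matrix.map_apply, Matrix.submatrix_apply, Matrix.of_apply, id]
    rw [divdiff_unique k n (hD i r c) (hB _ c)]
  · intro t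
    have h1 : ∀ c : Fin (n + 1), tau k n (D (i0 t) (r0 t) c) * (C (X c) - X c) =
      (fun j : ℕ => tau k n (aeval (mixv k n j) (f t)) -
        tau k n (aeval (mixv k n (j + 1)) (f t))) c := by
      intro c
      have := congrArg (tau k n) (hB t c)
      rw [map_mul, map_sub, map_sub, tau_inl, tau_inr] at this
      exact this
    simp only [Matrix.of_apply]
    rw [Finset.sum_congr rfl fun c _ => h1 c]
    refine (Fin.sum_univ_eq_sum_range (fun j : ℕ => tau k n (aeval (mixv k n j) (f t)) -
        tau k n (aeval (mixv k n (j + 1)) (f t))) (n + 1)).trans ?_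
    rw [Finset.sum_range_sub' (fun j : ℕ => tau k n (aeval (mixv k n j) (f t))),
      tau_mixv_zero, tau_mixv_top]
  · intro t c
    exact tau_TH k n (divdiff_hom k n hd (hf t) (hB t c))

end Div


section Four
variable {k : Type*} [Field k] {N : ℕ}

lemma hc_mem {σ : Type*} {ι : Type*} [Fintype ι] {d : ℕ} (f : ι → MvPolynomial σ k)
    (hf : ∀ i, (f i).IsHomogeneous d) (b : ℕ) {p : MvPolynomial σ k}
    (hp : p ∈ Ideal.span (Set.range f)) :
    homogeneousComponent b p ∈ Ideal.span (Set.range f) := by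
  obtain ⟨c, rfl⟩ := Ideal.mem_span_range_iff_exists_fun.1 hp
  rw [map_sum]
  refine Ideal.sum_mem _ fun i _ => ?_
  rw [hc_mul (hf i)]
  split_ifs
  · exact Ideal.mul_mem_left _ _ (Ideal.subset_span ⟨i, rfl⟩)
  · exact Ideal.zero_mem _

lemma exists_U {d : ℕ} (f : Fin (N + 1) → MvPolynomial (Fin N) k)
    (hf : ∀ i, (f i).IsHomogeneous d)
    (hz : ∀ x : Fin N → AlgebraicClosure k, (∀ i, aeval x (f i) = 0) → x = 0) :
    ∃ s, 1 ≤ s ∧ d ≤ s ∧ ∃ U : Fin N → Fin (N + 1) → MvPolynomial (Fin N) k,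
      (∀ r i, (U r i).IsHomogeneous (s - d)) ∧ ∀ r, U r ⬝ᵥ f = X r ^ s := by
  have h1 : ∀ c : Fin N, ∃ e : ℕ, (X c : MvPolynomial (Fin N) k) ^ e ∈ Ideal.span (Set.range f) := by
    intro c
    have h2 : (X c : MvPolynomial (Fin N) k) ∈
        vanishingIdeal k (zeroLocus (AlgebraicClosure k) (Ideal.span (Set.range f))) := by
      rw [mem_vanishingIdeal_iff]
      intro x hx
      have := hz x (fun i => hx _ (Ideal.subset_span ⟨i, rfl⟩))
      simp [this]
    rw [vanishingIdeal_zeroLocus_eq_radical] at h2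
    exact h2
  choose e he using h1
  let s := d + 1 + ∑ c, e c
  have hs : ∀ c, (X c : MvPolynomial (Fin N) k) ^ s ∈ Ideal.span (Set.range f) := by
    intro c
    refine Ideal.pow_mem_of_pow_mem _ (he c) ?_
    have := Finset.single_le_sum (f := e) (fun _ _ => Nat.zero_le _) (Finset.mem_univ c)
    omega
  have h3 : ∀ c, ∃ u : Fin (N + 1) → MvPolynomial (Fin N) k,
      ∑ i, u i * f i = X c ^ s := fun c => Ideal.mem_span_range_iff_exists_fun.1 (hs c)
  choose u hu using h3
  refine ⟨s, by omega, by omega, fun r i => homogeneousComponent (s - d) (u r i),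
    fun r i => homogeneousComponent_isHomogeneous _ _, fun r => ?_⟩
  have h4 := congrArg (homogeneousComponent s) (hu r)
  rw [map_sum, homogeneousComponent_of_mem (isHomogeneous_X_pow r s), if_pos rfl] at h4
  rw [← h4]
  refine Finset.sum_congr rfl fun i _ => ?_
  rw [hc_mul (hf i), if_pos (by omega)]

/-- coefficientwise application of a functional -/
def Phi (φ : MvPolynomial (Fin N) k →ₗ[k] k)
    (Q : MvPolynomial (Fin N) (MvPolynomial (Fin N) k)) : MvPolynomial (Fin N) k :=
  ∑ α ∈ Q.support, monomial α (φ (coeff α Q))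

lemma coeff_Phi (φ : MvPolynomial (Fin N) k →ₗ[k] k)
    (Q : MvPolynomial (Fin N) (MvPolynomial (Fin N) k)) (α) :
    coeff α (Phi φ Q) = φ (coeff α Q) := by
  classical
  rw [Phi, coeff_sum]
  simp only [coeff_monomial]
  rw [Finset.sum_ite_eq']
  split_ifs with h
  · rfl
  · rw [notMem_support_iff.1 h, map_zero]

lemma Phi_sum (φ : MvPolynomial (Fin N) k →ₗ[k] k) {ι : Type*} (s : Finset ι)
    (Q : ι → MvPolynomial (Fin N) (MvPolynomial (Fin N) k)) :
    Phi φ (∑ i ∈ s, Q i) = ∑ i ∈ s, Phi φ (Q i) := by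
  ext α
  simp [coeff_Phi, coeff_sum]

lemma Phi_map_mul (φ : MvPolynomial (Fin N) k →ₗ[k] k) (q : MvPolynomial (Fin N) k)
    (Q : MvPolynomial (Fin N) (MvPolynomial (Fin N) k)) :
    Phi φ (map C q * Q) = q * Phi φ Q := by
  ext α
  rw [coeff_Phi, coeff_mul, coeff_mul, map_sum]
  refine Finset.sum_congr rfl fun x _ => ?_
  rw [coeff_map, coeff_Phi, ← smul_eq_C_mul, map_smul, smul_eq_mul]

/-- top exponent -/
def topE (N s : ℕ) : Fin N →₀ ℕ := Finsupp.equivFunOnFinite.symm fun _ => s - 1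

lemma topE_apply (s : ℕ) (j : Fin N) : topE N s j = s - 1 := rfl

/-- the determinant pairing -/
def Xi (U : Fin N → Fin (N + 1) → MvPolynomial (Fin N) k) (s : ℕ) :
    (Fin (N + 1) → MvPolynomial (Fin N) k) →ₗ[k] MvPolynomial (Fin N) k →ₗ[k] k :=
  LinearMap.mk₂ k (fun v p => coeff (topE N s)
    (p * (Matrix.of (Fin.cons v U : Fin (N + 1) → Fin (N + 1) → MvPolynomial (Fin N) k)).det))
    (by
      intro v w p
      rw [← coeff_add, ← mul_add]
      congr 2
      simp only [det_cons_row, ← Finset.sum_add_distrib]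
      refine Finset.sum_congr rfl fun i _ => ?_
      simp only [Pi.add_apply]; ring)
    (by
      intro c v p
      rw [smul_eq_mul, ← coeff_C_mul, mul_left_comm]
      congr 2
      simp only [det_cons_row, Finset.mul_sum]
      refine Finset.sum_congr rfl fun i _ => ?_
      simp only [Pi.smul_apply, smul_eq_C_mul]; ring)
    (by intro v p q; rw [← coeff_add, add_mul])
    (by intro c v p; rw [smul_mul_assoc, coeff_smul])

lemma Xi_apply (U : Fin N → Fin (N + 1) → MvPolynomial (Fin N) k) (s : ℕ) (v p) :
    Xi U s v p = coeff (topE N s)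
    (p * (Matrix.of (Fin.cons v U : Fin (N + 1) → Fin (N + 1) → MvPolynomial (Fin N) k)).det) := rfl

lemma coeff_top_mem {s : ℕ} (hs : 1 ≤ s) {p : MvPolynomial (Fin N) k}
    (hp : p ∈ Ideal.span (Set.range fun j => (X j : MvPolynomial (Fin N) k) ^ s)) :
    coeff (topE N s) p = 0 := by
  by_contra h
  obtain ⟨j, hj⟩ := (mem_span_range_iff s p).1 hp _ (mem_support_iff.2 h)
  rw [topE_apply] at hj
  omega

section
variable {d s : ℕ} (hs : 1 ≤ s) (hds : d ≤ s) (f : Fin (N + 1) → MvPolynomial (Fin N) k)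
  (U : Fin N → Fin (N + 1) → MvPolynomial (Fin N) k)
  (hg : ∀ r, U r ⬝ᵥ f = X r ^ s)
include hs hg

lemma Xi_I (v : Fin (N + 1) → MvPolynomial (Fin N) k) (hv : v ⬝ᵥ f = 0) {p}
    (hp : p ∈ Ideal.span (Set.range f)) : Xi U s v p = 0 := by
  rw [Xi_apply]
  refine coeff_top_mem hs ?_
  obtain ⟨c, rfl⟩ := Ideal.mem_span_range_iff_exists_fun.1 hp
  rw [Finset.sum_mul]
  refine Ideal.sum_mem _ fun i _ => ?_
  have := Ideal.mul_mem_left _ (c i) (cons_mul_mem f U _ hg v hv i)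
  rwa [mul_assoc, mul_comm (f i)]

lemma Xi_kosz (p : MvPolynomial (Fin N) k) (i j : Fin (N + 1)) (hij : i ≠ j) (v)
    (hv : ∀ t, v t = p * (if t = i then f j else if t = j then -f i else 0)) : Xi U s v = 0 := by
  refine LinearMap.ext fun q => ?_
  rw [Xi_apply]
  exact coeff_top_mem hs (Ideal.mul_mem_left _ _ (cons_kosz_mem f U _ hg p i j hij v hv))

include hds in
lemma Xi_ker (hd : 1 ≤ d) (hU : ∀ r i, (U r i).IsHomogeneous (s - d)) {a b : ℕ}
    (hab : a + b = N * (d - 1))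
    (v : Fin (N + 1) → MvPolynomial (Fin N) k) (hv : v ⬝ᵥ f = 0)
    (hva : ∀ i, (v i).IsHomogeneous a)
    (h : ∀ p, p.IsHomogeneous b → Xi U s v p = 0)
    (P : Submodule (MvPolynomial (Fin N) k) (Fin (N + 1) → MvPolynomial (Fin N) k))
    (hP : ∀ a w, (a ⬝ᵥ f) • w - (w ⬝ᵥ f) • a ∈ P) : v ∈ P := by
  refine syz_koszul f v hv U _ hg (fun i l hi p => pow_reg s i l hi p) ?_ P hP
  rw [mem_span_range_iff]
  set δ := (Matrix.of (Fin.cons v U : Fin (N + 1) → Fin (N + 1) → MvPolynomial (Fin N) k)).det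
    with hδ
  have hδh : δ.IsHomogeneous (a + N * (s - d)) := by
    rw [hδ, det_cons_row]
    refine IsHomogeneous.sum _ _ _ fun i _ => ?_
    have h1 : ((-1 : MvPolynomial (Fin N) k) ^ (i : ℕ)).IsHomogeneous 0 := by
      have := (isHomogeneous_C (Fin N) (-1 : k)).pow i
      simpa using this
    have h2 := hom_det ((Matrix.of U).submatrix id i.succAbove) (fun r c => hU _ _)
    have := (h1.mul (hva i)).mul h2
    rwa [zero_add] at this
  intro m hm
  by_contra! hlt
  have hle : m ≤ topE N s := fun j => by
    rw [topE_apply]; have := hlt j; omega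
  have hsum : ∑ j, m j = a + N * (s - d) := hom_sum hδh (mem_support_iff.1 hm)
  have e1 : (topE N s - m) + m = topE N s := tsub_add_cancel_of_le hle
  have e2 : ∑ j, (topE N s - m) j + ∑ j, m j = N * (s - 1) := by
    rw [← Finset.sum_add_distrib]
    have : ∀ j, (topE N s - m) j + m j = s - 1 := fun j => by
      rw [← Finsupp.add_apply, e1, topE_apply]
    rw [Finset.sum_congr rfl fun j _ => this j]
    simp
  have e3 : N * (s - 1) = N * (s - d) + N * (d - 1) := by
    rw [← mul_add]; congr 1; omega
  have h5 := h (monomial (topE N s - m) 1) (isHomogeneous_monomial _ (by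
    rw [Finsupp.degree_eq_sum]; omega))
  rw [Xi_apply] at h5
  rw [← hδ] at h5
  have h6 := coeff_monomial_mul m (topE N s - m) (1 : k) δ
  rw [e1, h5, one_mul] at h6
  exact mem_support_iff.1 hm h6.symm

end

end Four


section Five
variable {k : Type*} [Field k] {N : ℕ}

/-- the ideal `(f(x), y^s)` -/
def JJ (f : Fin (N + 1) → MvPolynomial (Fin N) k) (s : ℕ) :
    Ideal (MvPolynomial (Fin N) (MvPolynomial (Fin N) k)) :=
  Ideal.span (Set.range (fun i => C (f i)) ∪ Set.range (fun j : Fin N => X j ^ s))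

lemma JJ_coeff {s : ℕ} (hs : 1 ≤ s) (f : Fin (N + 1) → MvPolynomial (Fin N) k) {Q}
    (hQ : Q ∈ JJ f s) : ∀ α : Fin N →₀ ℕ, α ≤ topE N s → coeff α Q ∈ Ideal.span (Set.range f) := by
  rw [JJ] at hQ
  induction hQ using Submodule.span_induction with
  | mem x h =>
    intro α hα
    rcases h with ⟨i, rfl⟩ | ⟨j, rfl⟩
    · simp only [coeff_C]
      split_ifs
      · exact Ideal.subset_span ⟨i, rfl⟩
      · exact Ideal.zero_mem _
    · simp only [coeff_X_pow]
      split_ifs with h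
      · have := hα j
        rw [← h, topE_apply] at this
        simp at this
        omega
      · exact Ideal.zero_mem _
  | zero => intro α _; simp
  | add x y _ _ hx hy =>
    intro α hα
    rw [coeff_add]
    exact Ideal.add_mem _ (hx α hα) (hy α hα)
  | smul a x _ hx =>
    intro α hα
    rw [smul_eq_mul, coeff_mul]
    refine Ideal.sum_mem _ fun z hz => Ideal.mul_mem_left _ _ (hx _ ?_)
    rw [Finset.HasAntidiagonal.mem_antidiagonal] at hz
    refine le_trans ?_ hα
    rw [← hz]
    exact le_add_self

section
variable {d s : ℕ} (hd : 1 ≤ d) (hs : 1 ≤ s) (hds : d ≤ s)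
  (f : Fin (N + 1) → MvPolynomial (Fin N) k)
  (hf : ∀ i, (f i).IsHomogeneous d)
  (U : Fin N → Fin (N + 1) → MvPolynomial (Fin N) k)
  (hg : ∀ r, U r ⬝ᵥ f = X r ^ s)
  (hU : ∀ r i, (U r i).IsHomogeneous (s - d))
  (A : Matrix (Fin (N + 1)) (Fin N) (MvPolynomial (Fin N) (MvPolynomial (Fin N) k)))
  (hA : ∀ t, ∑ c, A t c * (C (X c) - X c) = C (f t) - map C (f t))
  (hAh : ∀ t c, TH (d - 1) (A t c))

/-- the product matrix -/
def BB (U : Fin N → Fin (N + 1) → MvPolynomial (Fin N) k)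
    (A : Matrix (Fin (N + 1)) (Fin N) (MvPolynomial (Fin N) (MvPolynomial (Fin N) k))) :
    Matrix (Fin N) (Fin N) (MvPolynomial (Fin N) (MvPolynomial (Fin N) k)) :=
  (Matrix.of fun r i => (map C (U r i) : MvPolynomial (Fin N) (MvPolynomial (Fin N) k))) * A

lemma det_Phi (φ : MvPolynomial (Fin N) k →ₗ[k] k) :
    (Matrix.of (Fin.cons (fun i => Phi φ (sminor A i)) U :
      Fin (N + 1) → Fin (N + 1) → MvPolynomial (Fin N) k)).det = Phi φ (BB U A).det := by
  rw [BB, ← cauchy_binet]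
  have h1 := det_cons_row (sminor A)
    (fun r i => (map C (U r i) : MvPolynomial (Fin N) (MvPolynomial (Fin N) k)))
  refine Eq.trans ?_ (congrArg (Phi φ) h1).symm
  rw [Phi_sum, det_cons_row]
  refine Finset.sum_congr rfl fun i _ => ?_
  have h2 : ((Matrix.of fun r i => (map C (U r i) : MvPolynomial (Fin N) (MvPolynomial (Fin N) k))).submatrix
      id i.succAbove).det = map C ((Matrix.of U).submatrix id i.succAbove).det := by
    rw [RingHom.map_det]
    rfl
  have h3 : (-1) ^ (i : ℕ) * sminor A i * (map C ((Matrix.of U).submatrix id i.succAbove).det) =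
    map C ((-1) ^ (i : ℕ) * ((Matrix.of U).submatrix id i.succAbove).det) * sminor A i := by
    rw [map_mul, map_pow, map_neg, map_one]
    ring
  rw [h2, h3, Phi_map_mul]
  ring

include hA hg in
lemma BB_mulVec (l : Fin N) : (BB U A).mulVec (fun c => C (X c) - X c) l =
    ∑ i, map C (U l i) * C (f i) - X l ^ s := by
  rw [BB, ← Matrix.mulVec_mulVec]
  have h1 : A.mulVec (fun c => C (X c) - X c) = fun t => C (f t) - map C (f t) := funext hA
  rw [h1]
  simp only [Matrix.mulVec, dotProduct, Matrix.of_apply, mul_sub, Finset.sum_sub_distrib]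
  congr 1
  have h2 := congrArg (map (C : k →+* MvPolynomial (Fin N) k)) (hg l)
  rw [dotProduct, map_sum, map_pow, map_X] at h2
  rw [← h2]
  simp only [map_mul]

include hA hg in
lemma diff_mem (p : MvPolynomial (Fin N) k) : (C p - map C p) * (BB U A).det ∈ JJ f s := by
  induction p using MvPolynomial.induction_on with
  | C a => simp
  | add p q hp hq =>
    have := Ideal.add_mem _ hp hq
    rw [map_add, map_add]
    convert this using 1
    ring
  | mul_X p c hp =>
    have h1 : (BB U A).det * (C (X c) - X c) ∈ JJ f s := by
      rw [cramer_mem (BB U A) (fun c => C (X c) - X c) c]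
      refine Ideal.sum_mem _ fun l _ => Ideal.mul_mem_left _ _ ?_
      rw [BB_mulVec f U hg A hA]
      refine Ideal.sub_mem _ (Ideal.sum_mem _ fun i _ => Ideal.mul_mem_left _ _ ?_) ?_
      · exact Ideal.subset_span (Or.inl ⟨i, rfl⟩)
      · exact Ideal.subset_span (Or.inr ⟨l, rfl⟩)
    have := Ideal.add_mem _ (Ideal.mul_mem_left _ (C (X c)) hp) (Ideal.mul_mem_left _ (map C p) h1)
    convert this using 1
    rw [map_mul, map_mul, map_X]
    ring

include hAh hU hd hds in
lemma BB_TH : TH (N * (s - 1)) (BB U A).det := by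
  refine TH.det _ fun r c => ?_
  rw [BB, Matrix.mul_apply]
  refine TH.sum _ _ fun i _ => ?_
  have := (TH.map (hU r i)).mul (hAh i c)
  have e : s - d + (d - 1) = s - 1 := by omega
  rwa [e] at this

include hd hs hds hf hg hU hA hAh in
lemma Xi_Phi : ∃ c : k, c ≠ 0 ∧ ∀ φ : MvPolynomial (Fin N) k →ₗ[k] k,
    (∀ p ∈ Ideal.span (Set.range f), φ p = 0) →
    ∀ p, Xi U s (fun i => Phi φ (sminor A i)) p = c * φ p := by
  have hT := BB_TH hd hds U hU A hAh
  have hω := hT.coeff_hom (topE N s)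
  have e0 : ∑ j, topE N s j = N * (s - 1) := by simp [topE_apply]
  rw [e0, Nat.sub_self] at hω
  have hω2 : coeff (topE N s) (BB U A).det = C (coeff 0 (coeff (topE N s) (BB U A).det)) :=
    totalDegree_eq_zero_iff_eq_C.1 (Nat.le_zero.1 hω.totalDegree_le)
  set c := coeff 0 (coeff (topE N s) (BB U A).det) with hc
  refine ⟨c, ?_, ?_⟩
  · intro hc0
    let ev : MvPolynomial (Fin N) (MvPolynomial (Fin N) k) →+* MvPolynomial (Fin N) k :=
      map constantCoeff
    let B0 : Fin N → Fin N → MvPolynomial (Fin N) k := fun r c => ev (BB U A r c)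
    have hdet : (Matrix.of B0).det = ev (BB U A).det := by
      rw [RingHom.map_det]; rfl
    have hcoeff : ∀ β, coeff β (ev (BB U A).det) = coeff 0 (coeff β (BB U A).det) := fun β => by
      simp only [ev, coeff_map]
      rfl
    have h1 := det_not_mem (fun c => (X c : MvPolynomial (Fin N) k)) B0 (fun l => X l ^ s)
      (by
        intro l
        have h2 := congrArg ev (BB_mulVec f U hg A hA l)
        simp only [Matrix.mulVec, dotProduct, map_sum, map_sub, map_mul, map_pow] at h2
        have h3 : ∀ i, ev (C (f i)) = 0 := by
          intro i
          simp only [ev, map_C]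
          rw [constantCoeff_eq, (hf i).coeff_eq_zero, C_0]
          simp; omega
        have h4 : ∀ i : Fin N, ev (C (X i)) = 0 := by
          intro i
          simp [ev]
        have h5 : ∀ i : Fin N, ev (X i) = X i := by
          intro i
          simp [ev]
        simp only [h3, h4, h5, zero_sub, mul_zero, Finset.sum_const_zero, mul_neg,
          Finset.sum_neg_distrib, neg_inj] at h2
        exact h2)
      (fun i l hi p => pow_reg s i l hi p)
      (by
        rw [mem_span_range_iff, hdet]
        intro m hm
        have hh : (ev (BB U A).det).IsHomogeneous (N * (s - 1)) := by
          refine hom_of_sum fun m hm => ?_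
          rw [hcoeff] at hm
          simpa using hT m 0 hm
        refine (top_coeff s _ m hm hh).resolve_right ?_
        intro h
        rw [mem_support_iff, hcoeff, h] at hm
        exact hm hc0)
    have h6 : Ideal.span (Set.range fun c => (X c : MvPolynomial (Fin N) k)) ≤
        RingHom.ker (constantCoeff : MvPolynomial (Fin N) k →+* k) := by
      rw [Ideal.span_le]
      rintro _ ⟨c, rfl⟩
      simp
    have := h6 h1
    simp at this
  · intro φ hφ p
    rw [Xi_apply, det_Phi, ← Phi_map_mul, coeff_Phi]
    have h1 := JJ_coeff hs f (diff_mem f U hg A hA p) (topE N s) le_rfl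
    rw [sub_mul, coeff_sub, coeff_C_mul, hω2] at h1
    have h2 := hφ _ h1
    rw [map_sub, sub_eq_zero] at h2
    rw [← h2, mul_comm p, ← smul_eq_C_mul, map_smul, smul_eq_mul]

include hA in
lemma Phi_syz (φ : MvPolynomial (Fin N) k →ₗ[k] k)
    (hφ : ∀ p ∈ Ideal.span (Set.range f), φ p = 0) :
    ∑ i, Phi φ (sminor A i) * f i = 0 := by
  have h1 : ∑ i, sminor A i * (C (f i) - map C (f i)) = 0 := by
    simp only [← hA, Finset.mul_sum]
    rw [Finset.sum_comm]
    refine Finset.sum_eq_zero fun c _ => ?_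
    simp only [← mul_assoc, ← Finset.sum_mul, sminor_mul_col, zero_mul]
  simp only [mul_sub, Finset.sum_sub_distrib, sub_eq_zero] at h1
  have h2 : ∀ i, Phi φ (sminor A i) * f i = Phi φ (sminor A i * map C (f i)) := by
    intro i
    rw [mul_comm (sminor A i), Phi_map_mul, mul_comm]
  simp only [h2]
  rw [← Phi_sum, ← h1, Phi_sum]
  refine Finset.sum_eq_zero fun i _ => ?_
  ext α
  rw [coeff_Phi, mul_comm, coeff_C_mul, coeff_zero]
  exact hφ _ (Ideal.mul_mem_right _ _ (Ideal.subset_span ⟨i, rfl⟩))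

include hAh in
lemma sminor_TH (i) : TH (N * (d - 1)) (sminor A i) := by
  rw [sminor]
  have h1 : TH 0 ((-1 : MvPolynomial (Fin N) (MvPolynomial (Fin N) k)) ^ (i : ℕ)) := by
    simpa using TH.one.neg.pow (k := k) (N := N) i
  have := h1.mul (TH.det (A.submatrix i.succAbove id) fun r c => hAh _ _)
  rwa [zero_add] at this

include hAh in
lemma Phi_hom (φ : MvPolynomial (Fin N) k →ₗ[k] k) {a b : ℕ} (hab : a + b = N * (d - 1))
    (i) : (Phi (φ ∘ₗ homogeneousComponent b) (sminor A i)).IsHomogeneous a := by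
  refine hom_of_sum fun α hα => ?_
  rw [coeff_Phi, LinearMap.comp_apply] at hα
  have h1 : homogeneousComponent b (coeff α (sminor A i)) ≠ 0 := by
    intro h
    rw [h, map_zero] at hα
    exact hα rfl
  obtain ⟨β, hβ⟩ := exists_coeff_ne_zero h1
  have h2 := hom_sum (homogeneousComponent_isHomogeneous _ _) hβ
  have h3 : coeff β (coeff α (sminor A i)) ≠ 0 := by
    rw [coeff_homogeneousComponent] at hβ
    split_ifs at hβ
    · exact hβ
    · simp at hβ
  have h4 := sminor_TH A hAh i α β h3
  omega

end

end Five


section Six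
variable {k : Type*} [Field k] {n : ℕ}

lemma mem_gp {b : ℕ} {p : MvPolynomial (Fin (n + 1)) k} :
    p ∈ gradedPiece k n (b : ℤ) ↔ p.IsHomogeneous b := by
  rw [gradedPiece, if_pos (by positivity), Int.toNat_natCast, mem_homogeneousSubmodule]

lemma syzMap_apply (a : ℤ) (f : Fin (n + 2) → MvPolynomial (Fin (n + 1)) k)
    (v : Fin (n + 2) → ↥(gradedPiece k n a)) :
    syzMap k n a f v = ∑ i, (v i : MvPolynomial (Fin (n + 1)) k) * f i := by
  simp [syzMap]

/-- Koszul vectors -/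
def kvec (f : Fin (n + 2) → MvPolynomial (Fin (n + 1)) k) (p : MvPolynomial (Fin (n + 1)) k)
    (i j : Fin (n + 2)) : Fin (n + 2) → MvPolynomial (Fin (n + 1)) k :=
  fun t => p * (if t = i then f j else if t = j then -f i else 0)

/-- Koszul span in the ambient space -/
def KK (a d : ℕ) (f : Fin (n + 2) → MvPolynomial (Fin (n + 1)) k) :
    Submodule k (Fin (n + 2) → MvPolynomial (Fin (n + 1)) k) :=
  Submodule.span k {v | ∃ p ∈ gradedPiece k n ((a : ℤ) - d), ∃ i j : Fin (n + 2), i < j ∧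
    v = kvec f p i j}

/-- inclusion of syzygies -/
def incl (a : ℤ) (f : Fin (n + 2) → MvPolynomial (Fin (n + 1)) k) :
    ↥(LinearMap.ker (syzMap k n a f)) →ₗ[k] (Fin (n + 2) → MvPolynomial (Fin (n + 1)) k) :=
  LinearMap.pi (fun i => (gradedPiece k n a).subtype ∘ₗ LinearMap.proj i ∘ₗ
    (LinearMap.ker (syzMap k n a f)).subtype)

lemma incl_apply (a : ℤ) (f : Fin (n + 2) → MvPolynomial (Fin (n + 1)) k)
    (z : ↥(LinearMap.ker (syzMap k n a f))) (t) :
    incl a f z t = ((z : Fin (n + 2) → ↥(gradedPiece k n a)) t : MvPolynomial (Fin (n + 1)) k) := rfl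

lemma incl_inj (a : ℤ) (f : Fin (n + 2) → MvPolynomial (Fin (n + 1)) k) :
    Function.Injective (incl a f) := by
  intro x y h
  apply Subtype.ext
  funext t
  apply Subtype.ext
  exact congrFun h t

lemma kvec_sum (f : Fin (n + 2) → MvPolynomial (Fin (n + 1)) k) (p) (i j : Fin (n + 2)) 
    (hij : i ≠ j) : ∑ t, kvec f p i j t * f t = 0 := by
  have : ∀ t, kvec f p i j t * f t = (if t = i then p * f j * f i else 0) +
      (if t = j then - (p * f j * f i) else 0) := by
    intro t
    by_cases h1 : t = i
    · subst h1
      simp [kvec, hij]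
    · by_cases h2 : t = j
      · subst h2
        simp [kvec, h1]; ring
      · simp [kvec, h1, h2]
  simp only [this, Finset.sum_add_distrib]
  simp

lemma mem_kosz_of {a d : ℕ} (f : Fin (n + 2) → MvPolynomial (Fin (n + 1)) k)
    (hf : ∀ i, (f i).IsHomogeneous d)
    (z : ↥(LinearMap.ker (syzMap k n (a : ℤ) f))) (hz : incl a f z ∈ KK a d f) :
    z ∈ koszulSyzygies k n a d f := by
  have h1 : KK a d f ≤ (koszulSyzygies k n a d f).map (incl a f) := by
    rw [KK, Submodule.span_le]
    rintro _ ⟨p, hp, i, j, hij, rfl⟩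
    have hh : ∀ t, kvec f p i j t ∈ gradedPiece k n (a : ℤ) := by
      intro t
      rw [mem_gp, kvec]
      by_cases hda : d ≤ a
      · have : (a : ℤ) - d = ((a - d : ℕ) : ℤ) := by omega
        rw [this, mem_gp] at hp
        have e : a - d + d = a := by omega
        rw [← e]
        refine hp.mul ?_
        split_ifs
        · exact hf j
        · exact (hf i).neg
        · exact isHomogeneous_zero _ _ _
      · rw [gradedPiece, if_neg (by omega)] at hp
        rw [(Submodule.mem_bot k).1 hp, zero_mul]
        exact isHomogeneous_zero _ _ _
    refine ⟨⟨fun t => ⟨_, hh t⟩, ?_⟩, ?_, ?_⟩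
    · rw [LinearMap.mem_ker, syzMap_apply]
      exact kvec_sum f p i j hij.ne
    · exact Submodule.subset_span ⟨p, hp, i, j, hij, fun t => rfl⟩
    · rfl
  obtain ⟨y, hy, hyz⟩ := h1 hz
  rwa [← incl_inj _ _ hyz]

/-- componentwise homogeneous component -/
def hcv (a : ℕ) : (Fin (n + 2) → MvPolynomial (Fin (n + 1)) k) →ₗ[k]
    (Fin (n + 2) → MvPolynomial (Fin (n + 1)) k) :=
  LinearMap.pi fun i => homogeneousComponent a ∘ₗ LinearMap.proj i

lemma hcv_kvec {a d : ℕ} (f : Fin (n + 2) → MvPolynomial (Fin (n + 1)) k)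
    (hf : ∀ i, (f i).IsHomogeneous d) (p) (i j : Fin (n + 2)) (hij : i < j) :
    hcv a (kvec f p i j) ∈ KK a d f := by
  have hw : ∀ t, (if t = i then f j else if t = j then -f i else 0).IsHomogeneous d := by
    intro t
    split_ifs
    · exact hf j
    · exact (hf i).neg
    · exact isHomogeneous_zero _ _ _
  by_cases hda : d ≤ a
  · refine Submodule.subset_span ⟨homogeneousComponent (a - d) p, ?_, i, j, hij, ?_⟩
    · have : (a : ℤ) - d = ((a - d : ℕ) : ℤ) := by omega
      rw [this, mem_gp]
      exact homogeneousComponent_isHomogeneous _ _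
    · funext t
      have := hc_mul (hw t) a p
      rw [if_pos hda] at this
      exact this
  · have : hcv a (kvec f p i j) = 0 := by
      funext t
      have := hc_mul (hw t) a p
      rw [if_neg hda] at this
      exact this
    rw [this]
    exact Submodule.zero_mem _

lemma kvec_expand (f a w : Fin (n + 2) → MvPolynomial (Fin (n + 1)) k)
    (q : MvPolynomial (Fin (n + 1)) k) :
    q • ((a ⬝ᵥ f) • w - (w ⬝ᵥ f) • a) =
      ∑ i, ∑ j, q • (a j * w i) • (f j • (Pi.single i 1 : Fin (n + 2) → MvPolynomial (Fin (n + 1)) k)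
        - f i • Pi.single j 1) := by
  funext t
  simp only [Pi.smul_apply, Pi.sub_apply, Finset.sum_apply, smul_eq_mul, mul_sub,
    Finset.sum_sub_distrib, dotProduct, Finset.sum_mul, Finset.mul_sum, Pi.single_apply,
    mul_ite, mul_one, mul_zero]
  congr 1
  · rw [Finset.sum_comm]
    simp only [Finset.sum_ite_eq, Finset.mem_univ, if_true]
    exact Finset.sum_congr rfl fun i _ => by ring
  · simp only [Finset.sum_ite_eq, Finset.mem_univ, if_true]
    exact Finset.sum_congr rfl fun i _ => by ring

lemma kvec_eq (f : Fin (n + 2) → MvPolynomial (Fin (n + 1)) k) (p) (i j : Fin (n + 2))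
    (hij : i ≠ j) : kvec f p i j =
      p • (f j • (Pi.single i 1 : Fin (n + 2) → MvPolynomial (Fin (n + 1)) k)
        - f i • Pi.single j 1) := by
  funext t
  by_cases h1 : t = i
  · subst h1
    simp [kvec, hij]
  · by_cases h2 : t = j
    · subst h2
      simp [kvec, h1]
    · simp [kvec, h1, h2]

/-- The `S`-submodule used to extract the Koszul span. -/
def PP (a d : ℕ) (f : Fin (n + 2) → MvPolynomial (Fin (n + 1)) k) :
    Submodule (MvPolynomial (Fin (n + 1)) k) (Fin (n + 2) → MvPolynomial (Fin (n + 1)) k) where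
  carrier := {v | ∀ q : MvPolynomial (Fin (n + 1)) k, hcv a (q • v) ∈ KK a d f}
  add_mem' := by
    intro v w hv hw q
    rw [smul_add, map_add]
    exact Submodule.add_mem _ (hv q) (hw q)
  zero_mem' := by
    intro q
    rw [smul_zero, map_zero]
    exact Submodule.zero_mem _
  smul_mem' := by
    intro c v hv q
    rw [← mul_smul]
    exact hv _

lemma PP_mem {a d : ℕ} (f : Fin (n + 2) → MvPolynomial (Fin (n + 1)) k)
    (hf : ∀ i, (f i).IsHomogeneous d) (x w) :
    (x ⬝ᵥ f) • w - (w ⬝ᵥ f) • x ∈ PP a d f := by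
  intro q
  rw [kvec_expand, map_sum]
  refine Submodule.sum_mem _ fun i _ => ?_
  rw [map_sum]
  refine Submodule.sum_mem _ fun j _ => ?_
  rw [← mul_smul]
  rcases lt_trichotomy i j with h | h | h
  · rw [← kvec_eq _ _ _ _ h.ne]
    exact hcv_kvec f hf _ i j h
  · subst h
    rw [sub_self, smul_zero, map_zero]
    exact Submodule.zero_mem _
  · rw [← neg_sub, smul_neg, ← kvec_eq _ _ _ _ h.ne, map_neg]
    exact Submodule.neg_mem _ (hcv_kvec f hf _ j i h)

lemma KK_of_PP {a d : ℕ} (f : Fin (n + 2) → MvPolynomial (Fin (n + 1)) k)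
    (v : Fin (n + 2) → MvPolynomial (Fin (n + 1)) k) (hv : ∀ i, (v i).IsHomogeneous a)
    (h : v ∈ PP a d f) : v ∈ KK a d f := by
  have h1 := h 1
  rw [one_smul] at h1
  have : hcv a v = v := by
    funext t
    change homogeneousComponent a (v t) = v t
    rw [homogeneousComponent_of_mem (hv t), if_pos rfl]
  rwa [this] at h1

lemma bij_of {k E F : Type*} [Field k] [AddCommGroup E] [Module k E] [AddCommGroup F] [Module k F]
    (K : Submodule k F) (θ : E →ₗ[k] F) (ξ : F →ₗ[k] E) (c : k) (hc : c ≠ 0)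
    (h : ∀ x, ξ (θ x) = c • x) (h1 : ∀ v ∈ K, ξ v = 0) (h2 : ∀ v, ξ v = 0 → v ∈ K) :
    Function.Bijective (K.mkQ ∘ₗ θ) := by
  constructor
  · rw [← LinearMap.ker_eq_bot, LinearMap.ker_eq_bot']
    intro x hx
    have : θ x ∈ K := by simpa using hx
    have := h1 _ this
    rw [h] at this
    exact (smul_eq_zero.1 this).resolve_left hc
  · intro y
    obtain ⟨v, rfl⟩ := K.mkQ_surjective y
    refine ⟨c⁻¹ • ξ v, ?_⟩
    rw [LinearMap.comp_apply, ← sub_eq_zero, ← map_sub, Submodule.mkQ_apply,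
      Submodule.Quotient.mk_eq_zero]
    apply h2
    rw [map_sub, h, smul_inv_smul₀ hc, sub_self]

/-- extension of a functional by zero to all polynomials -/
def ext0 (b : ℕ) (φ : Module.Dual k ↥(gradedPiece k n (b : ℤ))) :
    MvPolynomial (Fin (n + 1)) k →ₗ[k] k :=
  φ ∘ₗ (homogeneousComponent b).codRestrict (gradedPiece k n (b : ℤ))
    (fun p => mem_gp.2 (homogeneousComponent_isHomogeneous b p))

lemma ext0_apply (b : ℕ) (φ : Module.Dual k ↥(gradedPiece k n (b : ℤ)))
    (p : ↥(gradedPiece k n (b : ℤ))) : ext0 b φ p = φ p := by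
  rw [ext0, LinearMap.comp_apply]
  congr 1
  apply Subtype.ext
  change homogeneousComponent b (p : MvPolynomial (Fin (n + 1)) k) = p
  rw [homogeneousComponent_of_mem (mem_gp.1 p.2), if_pos rfl]

lemma ext0_comp (b : ℕ) (φ : Module.Dual k ↥(gradedPiece k n (b : ℤ))) :
    ext0 b φ = ext0 b φ ∘ₗ homogeneousComponent b := by
  refine LinearMap.ext fun p => ?_
  have h := ext0_apply b φ ⟨_, mem_gp.2 (homogeneousComponent_isHomogeneous b p)⟩
  rw [LinearMap.comp_apply, h]
  rfl

lemma mem_vd {b : ℤ} {I : Ideal (MvPolynomial (Fin (n + 1)) k)}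
    {φ : Module.Dual k ↥(gradedPiece k n b)} :
    φ ∈ vanishingDual k n b I ↔ ∀ x : ↥(gradedPiece k n b),
      (x : MvPolynomial (Fin (n + 1)) k) ∈ I → φ x = 0 := by
  simp [vanishingDual, Submodule.mem_iInf]

lemma ext0_I {b d : ℕ} (f : Fin (n + 2) → MvPolynomial (Fin (n + 1)) k)
    (hf : ∀ i, (f i).IsHomogeneous d) {φ : Module.Dual k ↥(gradedPiece k n (b : ℤ))}
    (hφ : φ ∈ vanishingDual k n b (Ideal.span (Set.range f))) :
    ∀ p ∈ Ideal.span (Set.range f), ext0 b φ p = 0 := by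
  intro p hp
  rw [mem_vd] at hφ
  exact hφ _ (hc_mem f hf b hp)

end Six

theorem main_aux
    (k : Type*) [Field k] (n : ℕ) (d : ℕ) (hd : 1 ≤ d)
    (f : Fin (n + 2) → MvPolynomial (Fin (n + 1)) k)
    (hf : ∀ i, (f i).IsHomogeneous d)
    (hz : ∀ x : Fin (n + 1) → AlgebraicClosure k,
      (∀ i, aeval x (f i) = 0) → x = 0)
    (D : Fin (n + 2) →
      Matrix (Fin (n + 1)) (Fin (n + 1)) (MvPolynomial (Fin (n + 1) ⊕ Fin (n + 1)) k))
    (hD : ∀ (i : Fin (n + 2)) (r c : Fin (n + 1)),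
      IsDivDiff k n (f (i.succAbove r)) c (D i r c))
    (a b : ℕ) (hab : a + b = (n + 1) * (d - 1)) :
    ∃ ψ : ↥(vanishingDual k n (b : ℤ) (Ideal.span (Set.range f)))
        ≃ₗ[k] (↥(LinearMap.ker (syzMap k n a f)) ⧸ koszulSyzygies k n a d f),
      ∀ (φ : ↥(vanishingDual k n (b : ℤ) (Ideal.span (Set.range f))))
        (A : ↥(LinearMap.ker (syzMap k n a f)))
        (u : Fin (n + 2) → (Fin (n + 1) → ℕ) →
          ↥(gradedPiece k n (b : ℤ))),
        (∀ (i : Fin (n + 2)), ∀ β ∈ Finset.Nat.antidiagonalTuple (n + 1) a,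
          (u i β : MvPolynomial (Fin (n + 1)) k) =
            coeffY k n (D i).det (Finsupp.equivFunOnFinite.symm β)) →
        (∀ t : Fin (n + 2),
          ((A : Fin (n + 2) → ↥(gradedPiece k n a)) t : MvPolynomial (Fin (n + 1)) k) =
            (-1 : k) ^ (t : ℕ) •
              ∑ β ∈ Finset.Nat.antidiagonalTuple (n + 1) a,
                ((φ : Module.Dual k
                    ↥(gradedPiece k n (b : ℤ))) (u t β)) •
                  monomial (Finsupp.equivFunOnFinite.symm β) (1 : k)) →
        ψ φ = Submodule.Quotient.mk A := by
  obtain ⟨M, hM1, hM2, hM3⟩ := exists_A k n hd f hf D hD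
  obtain ⟨s, hs, hds, U, hU, hg⟩ := exists_U f hf hz
  obtain ⟨c, hc, hXP⟩ := Xi_Phi hd hs hds f hf U hg hU M hM2 hM3
  have hhom : ∀ (φ : Module.Dual k ↥(gradedPiece k n (b : ℤ))) (i : Fin (n + 2)),
      (Phi (ext0 b φ) (sminor M i)).IsHomogeneous a := by
    intro φ i
    rw [ext0_comp]
    exact Phi_hom M hM3 (ext0 b φ) hab i
  let θ : ↥(vanishingDual k n (b : ℤ) (Ideal.span (Set.range f))) →ₗ[k]
      ↥(LinearMap.ker (syzMap k n (a : ℤ) f)) :=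
    { toFun := fun φ => ⟨fun i => ⟨Phi (ext0 b φ) (sminor M i), mem_gp.2 (hhom φ i)⟩, by
        rw [LinearMap.mem_ker, syzMap_apply]
        exact Phi_syz f M hM2 _ (ext0_I f hf φ.2)⟩
      map_add' := by
        intro φ φ'
        apply Subtype.ext
        funext i
        apply Subtype.ext
        ext α
        change coeff α (Phi _ _) = coeff α (Phi _ _ + Phi _ _)
        rw [coeff_add, coeff_Phi, coeff_Phi, coeff_Phi]
        rfl
      map_smul' := by
        intro r φ
        apply Subtype.ext
        funext i
        apply Subtype.ext
        ext α
        change coeff α (Phi _ _) = coeff α (r • Phi _ _)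
        rw [coeff_smul, coeff_Phi, coeff_Phi]
        rfl }
  have hdot : ∀ v : ↥(LinearMap.ker (syzMap k n (a : ℤ) f)), incl a f v ⬝ᵥ f = 0 := by
    intro v
    have := v.2
    rw [LinearMap.mem_ker, syzMap_apply] at this
    exact this
  let ξ : ↥(LinearMap.ker (syzMap k n (a : ℤ) f)) →ₗ[k]
      ↥(vanishingDual k n (b : ℤ) (Ideal.span (Set.range f))) :=
    { toFun := fun v => ⟨Xi U s (incl a f v) ∘ₗ (gradedPiece k n (b : ℤ)).subtype, by
        rw [mem_vd]
        intro x hx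
        exact Xi_I hs f U hg _ (hdot v) hx⟩
      map_add' := by
        intro v w
        apply Subtype.ext
        refine LinearMap.ext fun p => ?_
        change Xi U s (incl a f (v + w)) p = Xi U s (incl a f v) p + Xi U s (incl a f w) p
        rw [map_add, map_add]
        rfl
      map_smul' := by
        intro r v
        apply Subtype.ext
        refine LinearMap.ext fun p => ?_
        change Xi U s (incl a f (r • v)) p = r • Xi U s (incl a f v) p
        rw [map_smul, map_smul]
        rfl }
  have hbij : Function.Bijective ((koszulSyzygies k n a d f).mkQ ∘ₗ θ) := by
    refine bij_of _ θ ξ c hc ?_ ?_ ?_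
    · intro φ
      apply Subtype.ext
      refine LinearMap.ext fun p => ?_
      refine (hXP (ext0 b φ) (ext0_I f hf φ.2) p).trans ?_
      rw [ext0_apply]
      rfl
    · intro v hv
      have : koszulSyzygies k n a d f ≤ LinearMap.ker ξ := by
        rw [koszulSyzygies, Submodule.span_le]
        rintro v ⟨p, hp, i, j, hij, hv⟩
        rw [SetLike.mem_coe, LinearMap.mem_ker]
        apply Subtype.ext
        refine LinearMap.ext fun q => ?_
        change Xi U s (incl a f v) q = 0
        rw [Xi_kosz hs f U hg p i j hij.ne (incl a f v) hv]
        rfl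
      exact this hv
    · intro v hv
      apply mem_kosz_of f hf
      have hva : ∀ i, (incl a f v i).IsHomogeneous a := fun i => 
        mem_gp.1 ((v : Fin (n + 2) → ↥(gradedPiece k n a)) i).2
      refine KK_of_PP f _ hva ?_
      refine Xi_ker hs hds f U hg hd hU hab _ (hdot v) hva ?_ _ (PP_mem f hf)
      intro p hp
      have := congrArg (fun ψ => (ψ : Module.Dual k ↥(gradedPiece k n (b : ℤ))) ⟨p, mem_gp.2 hp⟩)
        (congrArg Subtype.val hv)
      exact this
  refine ⟨LinearEquiv.ofBijective _ hbij, ?_⟩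
  intro φ A u hu hA
  have : θ φ = A := by
    apply Subtype.ext
    funext t
    apply Subtype.ext
    have h1 := hhom φ t
    have h2 : ((A : Fin (n + 2) → ↥(gradedPiece k n a)) t : MvPolynomial (Fin (n + 1)) k).IsHomogeneous a :=
      mem_gp.1 ((A : Fin (n + 2) → ↥(gradedPiece k n a)) t).2
    change Phi (ext0 b φ) (sminor M t) = _
    ext α
    by_cases hα : ∑ j, α j = a
    · have hα' : (α : Fin (n + 1) → ℕ) ∈ Finset.Nat.antidiagonalTuple (n + 1) a :=
        Finset.Nat.mem_antidiagonalTuple.2 hα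
      rw [hA t, coeff_smul, coeff_sum, Finset.sum_eq_single (α : Fin (n + 1) → ℕ)]
      · have e1 : Finsupp.equivFunOnFinite.symm (α : Fin (n + 1) → ℕ) = α := by
          ext; rfl
        have h3 := hu t α hα'
        rw [e1, hM1] at h3
        rw [e1, coeff_smul, coeff_monomial, if_pos rfl, coeff_Phi, sminor]
        have e2 : coeff α ((-1) ^ (t : ℕ) * (M.submatrix t.succAbove id).det) =
            ((-1 : k) ^ (t : ℕ)) • coeff α (M.submatrix t.succAbove id).det := by
          rw [smul_eq_C_mul, ← coeff_C_mul, map_pow, map_pow, map_neg, map_neg, map_one, map_one]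
        rw [e2, map_smul, ← h3, ext0_apply, smul_eq_mul, smul_eq_mul, smul_eq_mul, mul_one]
      · intro β _ hβ
        rw [coeff_smul, coeff_monomial, if_neg, smul_zero]
        intro h
        apply hβ
        rw [← h]
        rfl
      · intro h
        exact absurd hα' h
    · have h3 : coeff α (Phi (ext0 b φ) (sminor M t)) = 0 := by
        by_contra h
        exact hα (hom_sum h1 h)
      rw [h3]
      by_contra h
      exact hα (hom_sum h2 (Ne.symm h))
  rw [← this]
  rfl


/-- For `f_0,…,f_{n+1} ∈ S_d` linearly independent with no common
projective zero, `ρ = (n+1)(d−1)` and `0 ≤ a ≤ ρ`, sending a functional `φ` on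
`S_{ρ−a}` vanishing on `I_{ρ−a}` to (the class of) its Bezout syzygy induces a
`k`-linear isomorphism `(R_{ρ−a})^* ≅ Syz_{a+d}/Kosz_{a+d}`. -/
theorem bezout_syzygy_duality
    (k : Type*) [Field k] (n : ℕ) (d : ℕ) (hd : 1 ≤ d)
    (f : Fin (n + 2) → MvPolynomial (Fin (n + 1)) k)
    (hf : ∀ i, (f i).IsHomogeneous d)
    (hindep : LinearIndependent k f)
    (hz : ∀ x : Fin (n + 1) → AlgebraicClosure k,
      (∀ i, aeval x (f i) = 0) → x = 0)
    (D : Fin (n + 2) →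
      Matrix (Fin (n + 1)) (Fin (n + 1)) (MvPolynomial (Fin (n + 1) ⊕ Fin (n + 1)) k))
    (hD : ∀ (i : Fin (n + 2)) (r c : Fin (n + 1)),
      IsDivDiff k n (f (i.succAbove r)) c (D i r c))
    (a : ℕ) (ha : a ≤ (n + 1) * (d - 1)) :
    ∃ ψ : ↥(vanishingDual k n (((n + 1) * (d - 1) : ℤ) - a) (Ideal.span (Set.range f)))
        ≃ₗ[k] (↥(LinearMap.ker (syzMap k n a f)) ⧸ koszulSyzygies k n a d f),
      ∀ (φ : ↥(vanishingDual k n (((n + 1) * (d - 1) : ℤ) - a) (Ideal.span (Set.range f))))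
        (A : ↥(LinearMap.ker (syzMap k n a f)))
        (u : Fin (n + 2) → (Fin (n + 1) → ℕ) →
          ↥(gradedPiece k n (((n + 1) * (d - 1) : ℤ) - a))),
        (∀ (i : Fin (n + 2)), ∀ β ∈ Finset.Nat.antidiagonalTuple (n + 1) a,
          (u i β : MvPolynomial (Fin (n + 1)) k) =
            coeffY k n (D i).det (Finsupp.equivFunOnFinite.symm β)) →
        (∀ t : Fin (n + 2),
          ((A : Fin (n + 2) → ↥(gradedPiece k n a)) t : MvPolynomial (Fin (n + 1)) k) =
            (-1 : k) ^ (t : ℕ) •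
              ∑ β ∈ Finset.Nat.antidiagonalTuple (n + 1) a,
                ((φ : Module.Dual k
                    ↥(gradedPiece k n (((n + 1) * (d - 1) : ℤ) - a))) (u t β)) •
                  monomial (Finsupp.equivFunOnFinite.symm β) (1 : k)) →
        ψ φ = Submodule.Quotient.mk A := by
  obtain ⟨b, hb⟩ : ∃ b : ℕ, a + b = (n + 1) * (d - 1) := ⟨_, Nat.add_sub_cancel' ha⟩
  have hz' : (((n + 1) * (d - 1) : ℤ) - a) = (b : ℤ) := by
    have h1 : ((d - 1 : ℕ) : ℤ) = (d : ℤ) - 1 := by omega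
    have h2 : ((a + b : ℕ) : ℤ) = (((n + 1) * (d - 1) : ℕ) : ℤ) := by rw [hb]
    push_cast [h1] at h2
    linarith
  generalize (((n + 1) * (d - 1) : ℤ) - a) = z at hz'
  subst hz'
  exact main_aux k n d hd f hf hz D hD a b hb
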